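/- arXiv:2103.01645 — 3 statements merged into one kernel-verified Lean document; each statement's English description precedes it below -/
import Mathlib

section
/- Let p be a prime with p ≡ 3 (mod 4), and let S ⊆ 𝔽_p × 𝔽_p be a set such that every point x ∉ S is the fourth vertex of a (tilted) square whose other three vertices lie in S. Then |S| ≥ p^{12/11} − p^{3/5}. In particular, every square-saturated subset of 𝔽_p × 𝔽_p has size at least p^{12/11} − p^{3/5}. -/
/-- Cauchy–Schwarz on each fibre of `g`, weighted by the sizes of the fibres of `f`. -/
theorem exists_weight_card_fiber_sq_le {α β γ : Type*} [DecidableEq β] [DecidableEq γ]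
    (V : Finset α) (f : α → β) (g : α → γ) (F : Finset β) (K : Finset γ)
    (hf : ∀ v ∈ V, f v ∈ F) (hg : ∀ v ∈ V, g v ∈ K) :
    ∃ w : γ → ℝ, (∀ y, 0 ≤ w y) ∧ ∑ y ∈ K, w y ≤ F.card ∧
      ∀ y, ((V.filter fun v => g v = y).card : ℝ) ^ 2 ≤
        w y * ((V ×ˢ V).filter fun c => f c.1 = f c.2 ∧ g c.2 = y).card := by
  classical
  let n : α → ℝ := fun v => ((V.filter fun u => f u = f v).card : ℝ)
  have hn : ∀ v ∈ V, 0 < n v := fun v hv =>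
    Nat.cast_pos.2 (Finset.card_pos.2 ⟨v, Finset.mem_filter.2 ⟨hv, rfl⟩⟩)
  refine ⟨fun y => ∑ v ∈ V with g v = y, (n v)⁻¹, fun y => Finset.sum_nonneg fun v _ =>
    inv_nonneg.2 (Nat.cast_nonneg _), ?_, fun y => ?_⟩
  · rw [Finset.sum_fiberwise_of_maps_to hg, ← Finset.sum_fiberwise_of_maps_to hf]
    calc ∑ z ∈ F, ∑ v ∈ V with f v = z, (n v)⁻¹
        ≤ ∑ z ∈ F, (1 : ℝ) := Finset.sum_le_sum fun z _ => ?_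
      _ = F.card := by simp
    calc ∑ v ∈ V with f v = z, (n v)⁻¹
        = ∑ v ∈ V with f v = z, (((V.filter fun u => f u = z).card : ℝ))⁻¹ :=
          Finset.sum_congr rfl fun v hv => by
            simp only [n, (Finset.mem_filter.1 hv).2]
      _ ≤ 1 := by
          rw [Finset.sum_const, nsmul_eq_mul]
          exact mul_inv_le_one
  · have hcard : (((V ×ˢ V).filter fun c => f c.1 = f c.2 ∧ g c.2 = y).card : ℝ) =
        ∑ v ∈ V with g v = y, n v := by
      have hmaps : ∀ c ∈ (V ×ˢ V).filter fun c => f c.1 = f c.2 ∧ g c.2 = y,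
          c.2 ∈ V.filter fun v => g v = y := by
        intro c hc
        simp only [Finset.mem_filter, Finset.mem_product] at hc ⊢
        exact ⟨hc.1.2, hc.2.2⟩
      rw [Finset.card_eq_sum_card_fiberwise hmaps, Nat.cast_sum]
      refine Finset.sum_congr rfl fun v hv => ?_
      rw [Finset.mem_filter] at hv
      refine congrArg _ (Finset.card_bij' (fun c _ => c.1) (fun u _ => (u, v)) ?_ ?_ ?_ ?_)
      · rintro ⟨u, v'⟩ hc
        simp only [Finset.mem_filter, Finset.mem_product] at hc ⊢
        grind
      · intro u hu
        simp only [Finset.mem_filter, Finset.mem_product] at hu ⊢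
        grind
      · rintro ⟨u, v'⟩ hc
        simp only [Finset.mem_filter] at hc
        simp [hc.2]
      · intros; rfl
    have hcs := Finset.sum_sq_le_sum_mul_sum_of_sq_le_mul (V.filter fun v => g v = y)
      (r := fun _ => (1 : ℝ)) (f := fun v => (n v)⁻¹) (g := n)
      (fun v hv => inv_nonneg.2 (Nat.cast_nonneg _)) (fun v hv => Nat.cast_nonneg _)
      (fun v hv => by
        rw [one_pow, inv_mul_cancel₀ (hn v (Finset.mem_filter.1 hv).1).ne'])
    rw [hcard]
    simpa using hcs

/-- Lower bound for the number of chains `v₀ ∼ v₁ ∼ v₂ ∼ v₃`, where consecutive elements have the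
same image under `f`, `g`, `h` respectively. A chain is stored as `((v₀, v₁), (v₃, v₂))`. -/
theorem card_pow_four_le_card_chains {α β γ δ : Type*} [DecidableEq β] [DecidableEq γ]
    [DecidableEq δ] (V : Finset α) (f : α → β) (g : α → γ) (h : α → δ)
    (F : Finset β) (K : Finset γ) (H : Finset δ)
    (hf : ∀ v ∈ V, f v ∈ F) (hg : ∀ v ∈ V, g v ∈ K) (hh : ∀ v ∈ V, h v ∈ H) :
    V.card ^ 4 ≤ F.card * K.card * H.card *
      (((V ×ˢ V) ×ˢ (V ×ˢ V)).filter fun c =>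
        f c.1.1 = f c.1.2 ∧ g c.1.2 = g c.2.2 ∧ h c.2.1 = h c.2.2).card := by
  obtain ⟨w, hw0, hw, hwX⟩ := exists_weight_card_fiber_sq_le V f g F K hf hg
  obtain ⟨z, hz0, hz, hzX⟩ := exists_weight_card_fiber_sq_le V h g H K hh hg
  let X : γ → ℝ := fun y => ((V ×ˢ V).filter fun c => f c.1 = f c.2 ∧ g c.2 = y).card
  let Y : γ → ℝ := fun y => ((V ×ˢ V).filter fun c => h c.1 = h c.2 ∧ g c.2 = y).card
  have hX0 : ∀ y, 0 ≤ X y := fun y => Nat.cast_nonneg _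
  have hY0 : ∀ y, 0 ≤ Y y := fun y => Nat.cast_nonneg _
  set C := ((V ×ˢ V) ×ˢ (V ×ˢ V)).filter fun c =>
        f c.1.1 = f c.1.2 ∧ g c.1.2 = g c.2.2 ∧ h c.2.1 = h c.2.2 with hC
  have hCcard : (C.card : ℝ) = ∑ y ∈ K, X y * Y y := by
    have hmaps : ∀ c ∈ C, g c.1.2 ∈ K := by
      intro c hc
      simp only [hC, Finset.mem_filter, Finset.mem_product] at hc
      exact hg _ hc.1.1.2
    rw [Finset.card_eq_sum_card_fiberwise hmaps, Nat.cast_sum]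
    refine Finset.sum_congr rfl fun y _ => ?_
    simp only [X, Y]
    rw [← Nat.cast_mul, ← Finset.card_product]
    congr 2
    ext c
    simp only [hC, Finset.mem_filter, Finset.mem_product]
    grind
  have hVcard : (V.card : ℝ) = ∑ y ∈ K, ((V.filter fun v => g v = y).card : ℝ) := by
    rw [Finset.card_eq_sum_card_fiberwise hg, Nat.cast_sum]
  let P : γ → ℝ := fun y => √(X y * Y y)
  let Q : γ → ℝ := fun y => √(w y * z y)
  have hP : (∑ y ∈ K, P y) ^ 2 ≤ K.card * C.card := by
    rw [hCcard]
    refine sq_sum_le_card_mul_sum_sq.trans_eq ?_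
    congr 1
    exact Finset.sum_congr rfl fun y _ => Real.sq_sqrt (mul_nonneg (hX0 y) (hY0 y))
  have hQ : (∑ y ∈ K, Q y) ^ 2 ≤ F.card * H.card := by
    refine (Finset.sum_sq_le_sum_mul_sum_of_sq_le_mul K (fun y _ => hw0 y) (fun y _ => hz0 y)
      fun y _ => (Real.sq_sqrt (mul_nonneg (hw0 y) (hz0 y))).le).trans ?_
    exact mul_le_mul hw hz (Finset.sum_nonneg fun y _ => hz0 y) (Nat.cast_nonneg _)
  have hV : (V.card : ℝ) ^ 2 ≤ (∑ y ∈ K, P y) * ∑ y ∈ K, Q y := by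
    rw [hVcard]
    refine Finset.sum_sq_le_sum_mul_sum_of_sq_le_mul K (fun y _ => Real.sqrt_nonneg _)
      (fun y _ => Real.sqrt_nonneg _) fun y _ => ?_
    rw [← Real.sqrt_mul (mul_nonneg (hX0 y) (hY0 y))]
    refine Real.le_sqrt_of_sq_le ?_
    calc (((V.filter fun v => g v = y).card : ℝ) ^ 2) ^ 2
        = ((V.filter fun v => g v = y).card : ℝ) ^ 2 *
          ((V.filter fun v => g v = y).card : ℝ) ^ 2 := sq _
      _ ≤ (w y * X y) * (z y * Y y) :=
          mul_le_mul (hwX y) (hzX y) (sq_nonneg _) (mul_nonneg (hw0 y) (hX0 y))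
      _ = X y * Y y * (w y * z y) := by ring
  have key : (V.card : ℝ) ^ 4 ≤ F.card * K.card * H.card * C.card := by
    calc (V.card : ℝ) ^ 4 = ((V.card : ℝ) ^ 2) ^ 2 := by ring
      _ ≤ ((∑ y ∈ K, P y) * ∑ y ∈ K, Q y) ^ 2 := pow_le_pow_left₀ (by positivity) hV 2
      _ = (∑ y ∈ K, P y) ^ 2 * (∑ y ∈ K, Q y) ^ 2 := by ring
      _ ≤ (K.card * C.card) * (F.card * H.card) :=
          mul_le_mul hP hQ (sq_nonneg _) (by positivity)
      _ = F.card * K.card * H.card * C.card := by ring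
  exact_mod_cast key

/-- The number of pairs of elements of `G` with equal first coordinate. -/
theorem card_sq_le_card_mul_card_fst_eq {α β : Type*} [DecidableEq α]
    (G : Finset (α × β)) (A : Finset α) (hA : ∀ x ∈ G, x.1 ∈ A) :
    G.card ^ 2 ≤ A.card * ((G ×ˢ G).filter fun v => v.1.1 = v.2.1).card := by
  classical
  have hmaps : ∀ v ∈ (G ×ˢ G).filter fun v => v.1.1 = v.2.1, v.1.1 ∈ A := by
    intro v hv
    simp only [Finset.mem_filter, Finset.mem_product] at hv
    exact hA _ hv.1.1
  rw [Finset.card_eq_sum_card_fiberwise hmaps, Finset.card_eq_sum_card_fiberwise hA]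
  refine sq_sum_le_card_mul_sum_sq.trans_eq ?_
  congr 1
  refine Finset.sum_congr rfl fun a _ => ?_
  rw [sq, ← Finset.card_product]
  congr 1
  ext v
  simp only [Finset.mem_filter, Finset.mem_product]
  grind

/-- The Katz–Tao sums-differences inequality with exponent `11 / 6`. -/
theorem card_pow_six_le_of_injOn_sub {Z : Type*} [AddCommGroup Z] [DecidableEq Z]
    (G : Finset (Z × Z)) (A B C : Finset Z) (N : ℕ)
    (hA : ∀ x ∈ G, x.1 ∈ A) (hB : ∀ x ∈ G, x.2 ∈ B) (hC : ∀ x ∈ G, x.1 + x.2 ∈ C)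
    (hAN : A.card ≤ N) (hBN : B.card ≤ N) (hCN : C.card ≤ N)
    (hinj : Set.InjOn (fun x : Z × Z => x.1 - x.2) G) :
    G.card ^ 6 ≤ N ^ 11 := by
  set V := (G ×ˢ G).filter fun v => v.1.1 = v.2.1 with hVdef
  have hV : ∀ v ∈ V, v.1 ∈ G ∧ v.2 ∈ G ∧ v.1.1 = v.2.1 := by
    intro v hv
    simpa [hVdef, and_assoc] using hv
  have hGV : G.card ^ 2 ≤ N * V.card :=
    (card_sq_le_card_mul_card_fst_eq G A hA).trans (Nat.mul_le_mul_right _ hAN)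
  have hchain := card_pow_four_le_card_chains V
    (fun v => (v.1.1 + v.1.2, v.2.2)) (fun v => (v.1.2, v.2.1 + v.2.2))
    (fun v => (v.1.2, v.2.2)) (C ×ˢ B) (B ×ˢ C) (B ×ˢ B)
    (fun v hv => Finset.mem_product.2 ⟨hC _ (hV v hv).1, hB v.2 (hV v hv).2.1⟩)
    (fun v hv => Finset.mem_product.2 ⟨hB _ (hV v hv).1, hC _ (hV v hv).2.1⟩)
    (fun v hv => Finset.mem_product.2 ⟨hB _ (hV v hv).1, hB v.2 (hV v hv).2.1⟩)
  set T := ((V ×ˢ V) ×ˢ (V ×ˢ V)).filter fun c =>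
    (c.1.1.1.1 + c.1.1.1.2, c.1.1.2.2) = (c.1.2.1.1 + c.1.2.1.2, c.1.2.2.2) ∧
    (c.1.2.1.2, c.1.2.2.1 + c.1.2.2.2) = (c.2.2.1.2, c.2.2.2.1 + c.2.2.2.2) ∧
    (c.2.1.1.2, c.2.1.2.2) = (c.2.2.1.2, c.2.2.2.2) with hT
  have hTmem : ∀ c ∈ T, c.1.1 ∈ V ∧ c.1.2 ∈ V ∧ c.2.1 ∈ V ∧ c.2.2 ∈ V ∧
      c.1.1.1.1 + c.1.1.1.2 = c.1.2.1.1 + c.1.2.1.2 ∧ c.1.1.2.2 = c.1.2.2.2 ∧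
      c.1.2.1.2 = c.2.2.1.2 ∧ c.1.2.2.1 + c.1.2.2.2 = c.2.2.2.1 + c.2.2.2.2 ∧
      c.2.1.1.2 = c.2.2.1.2 ∧ c.2.1.2.2 = c.2.2.2.2 := by
    intro c hc
    simpa [hT, and_assoc] using hc
  have hTcard : T.card ≤ V.card * (N * N) := by
    have hle : T.card ≤ (V ×ˢ (A ×ˢ C)).card := by
      refine Finset.card_le_card_of_injOn
        (fun c => (c.1.1, c.2.2.1.1, c.2.1.1.1 + c.2.1.1.2)) ?_ ?_
      · intro c hc
        obtain ⟨h0, -, h3, h2, -⟩ := hTmem c hc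
        simp only [Finset.coe_product, Set.mem_prod, Finset.mem_coe]
        exact ⟨h0, hA _ (hV _ h2).1, hC _ (hV _ h3).1⟩
      · rintro ⟨⟨⟨⟨a₀, b₀⟩, a₀', b₀'⟩, ⟨a₁, b₁⟩, a₁', b₁'⟩, ⟨⟨a₃, b₃⟩, a₃', b₃'⟩, ⟨a₂, b₂⟩, a₂', b₂'⟩
          hc ⟨⟨⟨⟨c₀, d₀⟩, c₀', d₀'⟩, ⟨c₁, d₁⟩, c₁', d₁'⟩, ⟨⟨c₃, d₃⟩, c₃', d₃'⟩, ⟨c₂, d₂⟩, c₂', d₂'⟩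
          hd heq
        obtain ⟨h0, h1, h3, h2, e1, e2, e3, e4, e5, e6⟩ := hTmem _ hc
        obtain ⟨k0, k1, k3, k2, l1, l2, l3, l4, l5, l6⟩ := hTmem _ hd
        obtain ⟨-, -, h0⟩ := hV _ h0
        obtain ⟨-, -, h1⟩ := hV _ h1
        obtain ⟨-, -, h2⟩ := hV _ h2
        obtain ⟨-, hg, h3⟩ := hV _ h3
        obtain ⟨-, -, k0⟩ := hV _ k0
        obtain ⟨-, -, k1⟩ := hV _ k1
        obtain ⟨-, -, k2⟩ := hV _ k2
        obtain ⟨-, hk, k3⟩ := hV _ k3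
        simp only [Prod.mk.injEq] at *
        have hsub : a₃' - b₃' = c₃' - d₃' := by
          grind
        have := hinj hg hk hsub
        simp only [Prod.mk.injEq] at this
        grind
    refine hle.trans ?_
    rw [Finset.card_product, Finset.card_product]
    exact Nat.mul_le_mul_left _ (Nat.mul_le_mul hAN hCN)
  have hV3 : V.card ^ 3 ≤ N ^ 8 := by
    rcases Nat.eq_zero_or_pos V.card with h0 | hpos
    · simp [h0]
    · refine Nat.le_of_mul_le_mul_right ?_ hpos
      calc V.card ^ 3 * V.card = V.card ^ 4 := by ring
        _ ≤ _ := hchain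
        _ ≤ (N * N) * (N * N) * (N * N) * (V.card * (N * N)) := by
            simp only [Finset.card_product]
            gcongr
        _ = N ^ 8 * V.card := by ring
  calc G.card ^ 6 = (G.card ^ 2) ^ 3 := by ring
    _ ≤ (N * V.card) ^ 3 := Nat.pow_le_pow_left hGV 3
    _ = N ^ 3 * V.card ^ 3 := by ring
    _ ≤ N ^ 3 * N ^ 8 := Nat.mul_le_mul_left _ hV3
    _ = N ^ 11 := by ring

theorem rpow_sub_rpow_le_of_sq_sub_pow_six_le {p N : ℝ} (hp : 1 ≤ p) (hN : 0 ≤ N)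
    (h : (p ^ 2 - N) ^ 6 ≤ N ^ 11) :
    p ^ ((12 : ℝ) / 11) - p ^ ((3 : ℝ) / 5) ≤ N := by
  have hp0 : 0 ≤ p := zero_le_one.trans hp
  set t : ℝ := p ^ ((1 : ℝ) / 55) with ht
  have ht1 : 1 ≤ t := Real.one_le_rpow hp (by norm_num)
  have h12 : p ^ ((12 : ℝ) / 11) = t ^ 60 := by
    rw [ht, ← Real.rpow_natCast, ← Real.rpow_mul hp0]
    norm_num
  have h3 : p ^ ((3 : ℝ) / 5) = t ^ 33 := by
    rw [ht, ← Real.rpow_natCast, ← Real.rpow_mul hp0]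
    norm_num
  have hp2 : p ^ 2 = t ^ 110 := by
    rw [ht, ← Real.rpow_natCast, ← Real.rpow_natCast, ← Real.rpow_mul hp0]
    norm_num
  rw [h12, h3]
  rw [hp2] at h
  by_contra! hlt
  have hN60 : N ≤ t ^ 60 := hlt.le.trans (sub_le_self _ (by positivity))
  have hmul : N * t ^ 50 < t ^ 110 - N := by
    have h1 : N * t ^ 50 < (t ^ 60 - t ^ 33) * t ^ 50 :=
      mul_lt_mul_of_pos_right hlt (by positivity)
    have h2 : t ^ 60 ≤ t ^ 83 := pow_le_pow_right₀ ht1 (by norm_num)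
    have h4 : (t ^ 60 - t ^ 33) * t ^ 50 = t ^ 110 - t ^ 83 := by ring
    linarith
  have hlt6 : (N * t ^ 50) ^ 6 < (t ^ 110 - N) ^ 6 :=
    pow_lt_pow_left₀ hmul (by positivity) (by norm_num)
  have hle : N ^ 11 ≤ (N * t ^ 50) ^ 6 := by
    calc N ^ 11 = N ^ 6 * N ^ 5 := by ring
      _ ≤ N ^ 6 * (t ^ 60) ^ 5 := by gcongr
      _ = (N * t ^ 50) ^ 6 := by ring
  linarith


/-- Lower bound for square-saturated sets in `𝔽_p × 𝔽_p`, `p ≡ 3 (mod 4)`: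
if every point `x ∉ S` is the fourth vertex of a (tilted) square
`x, x + d, x + d⊥, x + d + d⊥` (`d ≠ 0`, `d⊥ = (-d₂, d₁)`) whose other three
vertices lie in `S`, then `|S| ≥ p^(12/11) - p^(3/5)`. -/
theorem square_saturated_lower_bound (p : ℕ) [Fact p.Prime] (hp4 : p % 4 = 3)
    (S : Finset (ZMod p × ZMod p))
    (hsat : ∀ x : ZMod p × ZMod p, x ∉ S →
      ∃ d : ZMod p × ZMod p, d ≠ 0 ∧
        x + d ∈ S ∧ x + (-d.2, d.1) ∈ S ∧ x + d + (-d.2, d.1) ∈ S) :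
    (p : ℝ) ^ ((12 : ℝ) / 11) - (p : ℝ) ^ ((3 : ℝ) / 5) ≤ (S.card : ℝ) := by

  classical
  have hp : p.Prime := Fact.out
  have h2 : (2 : ZMod p) ≠ 0 := by
    intro h
    have hdvd : p ∣ 2 := (ZMod.natCast_eq_zero_iff 2 p).1 (by exact_mod_cast h)
    have := Nat.le_of_dvd two_pos hdvd
    interval_cases p <;> omega
  choose! d _ hda hdb hdc using hsat
  let φ : ZMod p × ZMod p → ZMod p × ZMod p := fun a => (a.1 - a.2, a.1 + a.2)
  let ψ : ZMod p × ZMod p → ZMod p × ZMod p := fun b => (b.1 + b.2, b.2 - b.1)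
  let e : ZMod p × ZMod p → (ZMod p × ZMod p) × (ZMod p × ZMod p) :=
    fun x => (φ (x + d x), ψ (x + (-(d x).2, (d x).1)))
  have hsub : ∀ x, (e x).1 - (e x).2 = (2 * -x.2, 2 * x.1) := fun x => by
    ext <;> simp [e, φ, ψ] <;> ring
  have hadd : ∀ x, (e x).1 + (e x).2 = (2 : ZMod p) • (x + d x + (-(d x).2, (d x).1)) :=
    fun x => by ext <;> simp [e, φ, ψ] <;> ring
  have hinj : ∀ x y, (e x).1 - (e x).2 = (e y).1 - (e y).2 → x = y := by
    intro x y hxy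
    rw [hsub, hsub, Prod.mk.injEq, mul_right_inj' h2, mul_right_inj' h2, neg_inj] at hxy
    exact Prod.ext hxy.2 hxy.1
  have hcard := card_pow_six_le_of_injOn_sub (Sᶜ.image e) (S.image φ) (S.image ψ)
    (S.image fun c => (2 : ZMod p) • c) S.card
    (by
      simp only [Finset.mem_image, Finset.mem_compl, forall_exists_index, and_imp]
      rintro _ x hx rfl
      exact ⟨_, hda x hx, rfl⟩)
    (by
      simp only [Finset.mem_image, Finset.mem_compl, forall_exists_index, and_imp]
      rintro _ x hx rfl
      exact ⟨_, hdb x hx, rfl⟩)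
    (by
      simp only [Finset.mem_image, Finset.mem_compl, forall_exists_index, and_imp]
      rintro _ x hx rfl
      exact ⟨_, hdc x hx, (hadd x).symm⟩)
    Finset.card_image_le Finset.card_image_le Finset.card_image_le
    (by
      intro u hu v hv huv
      simp only [Finset.coe_image, Set.mem_image] at hu hv
      obtain ⟨x, -, rfl⟩ := hu
      obtain ⟨y, -, rfl⟩ := hv
      rw [hinj x y huv])
  rw [Finset.card_image_of_injective _ fun x y hxy => hinj x y (by rw [hxy])] at hcard
  have hcompl : (Sᶜ.card : ℝ) = (p : ℝ) ^ 2 - S.card := by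
    rw [Finset.card_compl, Nat.cast_sub (Finset.card_le_univ S), Fintype.card_prod, ZMod.card]
    push_cast
    ring
  refine rpow_sub_rpow_le_of_sq_sub_pow_six_le (by exact_mod_cast hp.one_le)
    (Nat.cast_nonneg _) ?_
  rw [← hcompl]
  exact_mod_cast hcard
end

section
/- For every ε > 0 there exists N₀ such that for all n ≥ N₀ the following holds: if S ⊆ [n] × [n] ⊂ ℤ² has the property that for every point a ∈ ([n] × [n]) \ S there are three elements of S which together with a form a (tilted) square, then |S| ≥ n^{12/11} − ε·n. -/
open Finset

/-- Summing the reciprocal fibre size over the domain counts the nonempty fibres. -/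
theorem sum_inv_card_fiber_le {α β : Type*} [DecidableEq β] (V : Finset α) (B : Finset β)
    (f : α → β) (hf : ∀ v ∈ V, f v ∈ B) :
    ∑ v ∈ V, ((#{w ∈ V | f w = f v} : ℕ) : ℝ)⁻¹ ≤ #B := by
  rw [← sum_fiberwise_of_maps_to hf, card_eq_sum_ones, Nat.cast_sum]
  refine sum_le_sum fun b _ => ?_
  have hsum : ∑ v ∈ V with f v = b, ((#{w ∈ V | f w = f v} : ℕ) : ℝ)⁻¹ =
      ∑ v ∈ V with f v = b, ((#{w ∈ V | f w = b} : ℕ) : ℝ)⁻¹ :=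
    sum_congr rfl fun v hv => by rw [(mem_filter.1 hv).2]
  rw [hsum, sum_const, nsmul_eq_mul, Nat.cast_one]
  exact mul_inv_le_one

theorem three_mul_le_add_of_pow_three_eq {x y z q : ℝ} (hx : 0 ≤ x) (hy : 0 ≤ y) (hz : 0 ≤ z)
    (h : q ^ 3 = x * y * z) : 3 * q ≤ x + y + z := by
  refine le_of_pow_le_pow_left₀ three_ne_zero (by positivity) ?_
  nlinarith [mul_nonneg hx (sq_nonneg (y - z)), mul_nonneg hy (sq_nonneg (x - z)),
    mul_nonneg hz (sq_nonneg (x - y)), mul_nonneg (add_nonneg (add_nonneg hx hy) hz)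
      (add_nonneg (add_nonneg (sq_nonneg (x - y)) (sq_nonneg (y - z))) (sq_nonneg (x - z)))]

theorem card_pow_three_le_sum_mul_mul_sum_inv_mul_sum_inv {α : Type*} (V : Finset α)
    (a b : α → ℝ) (ha : ∀ v ∈ V, 0 < a v) (hb : ∀ v ∈ V, 0 < b v) :
    (#V : ℝ) ^ 3 ≤ (∑ v ∈ V, a v * b v) * (∑ v ∈ V, (a v)⁻¹) * ∑ v ∈ V, (b v)⁻¹ := by
  rcases V.eq_empty_or_nonempty with rfl | hV
  · simp
  have hX := sum_pos (fun v hv => mul_pos (ha v hv) (hb v hv)) hV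
  have hY := sum_pos (fun v hv => inv_pos.2 (ha v hv)) hV
  have hZ := sum_pos (fun v hv => inv_pos.2 (hb v hv)) hV
  generalize hXdef : ∑ v ∈ V, a v * b v = X at *
  generalize hYdef : ∑ v ∈ V, (a v)⁻¹ = Y at *
  generalize hZdef : ∑ v ∈ V, (b v)⁻¹ = Z at *
  have hD : 0 < X * Y * Z := by positivity
  obtain ⟨q, hq, hq3⟩ : ∃ q : ℝ, 0 < q ∧ q ^ 3 = X * Y * Z :=
    ⟨(X * Y * Z) ^ ((3 : ℕ) : ℝ)⁻¹, Real.rpow_pos_of_pos hD _,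
      Real.rpow_inv_natCast_pow hD.le three_ne_zero⟩
  have key : ∑ v ∈ V, 3 * q⁻¹ ≤ 3 := by
    calc ∑ v ∈ V, 3 * q⁻¹
        ≤ ∑ v ∈ V, (a v * b v / X + (a v)⁻¹ / Y + (b v)⁻¹ / Z) := by
          refine sum_le_sum fun v hv => ?_
          have h1 := ha v hv
          have h2 := hb v hv
          refine three_mul_le_add_of_pow_three_eq (by positivity) (by positivity)
            (by positivity) ?_
          rw [inv_pow, hq3]
          field_simp
      _ = 3 := by
          rw [sum_add_distrib, sum_add_distrib, ← sum_div, ← sum_div, ← sum_div, hXdef, hYdef,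
            hZdef, div_self hX.ne', div_self hY.ne', div_self hZ.ne']
          norm_num
  rw [sum_const, nsmul_eq_mul] at key
  have hle : (#V : ℝ) ≤ q := by
    field_simp at key
    linarith
  exact hq3 ▸ pow_le_pow_left₀ (Nat.cast_nonneg _) hle 3

/-- Lower bound for the number of chains `u, v, w` in `V` with `f u = f v` and `g v = g w`. -/
theorem card_pow_three_le_sum_card_fiber_mul {α β γ : Type*} [DecidableEq β] [DecidableEq γ]
    (V : Finset α) (B : Finset β) (C : Finset γ) (f : α → β) (g : α → γ)
    (hf : ∀ v ∈ V, f v ∈ B) (hg : ∀ v ∈ V, g v ∈ C) :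
    #V ^ 3 ≤ (∑ v ∈ V, #{w ∈ V | f w = f v} * #{w ∈ V | g w = g v}) * #B * #C := by
  have h := card_pow_three_le_sum_mul_mul_sum_inv_mul_sum_inv V
    (fun v => (#{w ∈ V | f w = f v} : ℝ)) (fun v => (#{w ∈ V | g w = g v} : ℝ))
    (fun v hv => Nat.cast_pos.2 (card_pos.2 ⟨v, by simp [hv]⟩))
    (fun v hv => Nat.cast_pos.2 (card_pos.2 ⟨v, by simp [hv]⟩))
  have hB := sum_inv_card_fiber_le V B f hf
  have hC := sum_inv_card_fiber_le V C g hg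
  have hnonneg : (0 : ℝ) ≤ ∑ v ∈ V, (#{w ∈ V | f w = f v} : ℝ) * #{w ∈ V | g w = g v} :=
    sum_nonneg fun _ _ => mul_nonneg (Nat.cast_nonneg _) (Nat.cast_nonneg _)
  have h' := h.trans (mul_le_mul (mul_le_mul_of_nonneg_left hB hnonneg) hC
    (sum_nonneg fun _ _ => inv_nonneg.2 (Nat.cast_nonneg _))
    (mul_nonneg hnonneg (Nat.cast_nonneg _)))
  exact_mod_cast h'

/-- Cauchy–Schwarz for the number of pairs in a common fibre. -/
theorem card_sq_le_sum_card_fiber_mul {α β : Type*} [DecidableEq β]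
    (V : Finset α) (B : Finset β) (f : α → β) (hf : ∀ v ∈ V, f v ∈ B) :
    #V ^ 2 ≤ (∑ v ∈ V, #{w ∈ V | f w = f v}) * #B := by
  rcases V.eq_empty_or_nonempty with rfl | hV
  · simp
  have h := card_pow_three_le_sum_card_fiber_mul V B {()} f (fun _ => ()) hf (by simp)
  simp only [filter_true, ← sum_mul, card_singleton, mul_one] at h
  have hpos := card_pos.2 hV
  refine Nat.le_of_mul_le_mul_right (c := #V) ?_ hpos
  calc #V ^ 2 * #V = #V ^ 3 := by ring
    _ ≤ _ := h
    _ = _ := by ring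

/-- The Katz–Tao sums-differences inequality: if `G` has at most `m` first coordinates, second
coordinates and sums, then it has at most `m ^ (11 / 6)` differences. -/
theorem card_pow_six_le_of_injOn_sub_s7 {H : Type*} [AddCommGroup H] [DecidableEq H]
    (G : Finset (H × H)) (A B C : Finset H) (m : ℕ) (hA : #A ≤ m) (hB : #B ≤ m) (hC : #C ≤ m)
    (hGA : ∀ p ∈ G, p.1 ∈ A) (hGB : ∀ p ∈ G, p.2 ∈ B) (hGC : ∀ p ∈ G, p.1 + p.2 ∈ C)
    (hinj : Set.InjOn (fun p : H × H => p.1 - p.2) G) : #G ^ 6 ≤ m ^ 11 := by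
  set V : Finset (Σ _ : H × H, H × H) := G.sigma fun p => {q ∈ G | q.2 = p.2} with hV
  have hVcard : #G ^ 2 ≤ #V * m := by
    have h := card_sq_le_sum_card_fiber_mul G B Prod.snd hGB
    rw [← card_sigma] at h
    exact h.trans (Nat.mul_le_mul_left _ hB)
  have hmem : ∀ v ∈ V, v.1 ∈ G ∧ v.2 ∈ G ∧ v.2.2 = v.1.2 := fun v hv => by
    simpa [hV] using hv
  set f : (Σ _ : H × H, H × H) → H × H := fun v => (v.1.1, v.2.1) with hf
  set g : (Σ _ : H × H, H × H) → H × H := fun v => (v.1.1, v.2.1 + v.2.2) with hg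
  have hchain := card_pow_three_le_sum_card_fiber_mul V (A ×ˢ A) (A ×ˢ C) f g
    (fun v hv => mk_mem_product (hGA _ (hmem v hv).1) (hGA _ (hmem v hv).2.1))
    (fun v hv => mk_mem_product (hGA _ (hmem v hv).1) (hGC _ (hmem v hv).2.1))
  have hW : ∑ v ∈ V, #{w ∈ V | f w = f v} * #{w ∈ V | g w = g v} ≤ m ^ 4 := by
    simp_rw [← card_product]
    rw [← card_sigma]
    calc _ ≤ #((C ×ˢ C) ×ˢ (B ×ˢ A)) := by
          refine card_le_card_of_injOn
            (fun t => ((t.2.1.1.1 + t.2.1.1.2, t.2.1.2.1 + t.2.1.2.2), (t.1.1.2, t.2.2.2.1)))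
            ?_ ?_
          · rintro ⟨v, u, w⟩ ht
            simp only [coe_sigma, Set.mem_sigma_iff, mem_coe, mem_product, mem_filter] at ht
            obtain ⟨hv, ⟨hu, -⟩, hw, -⟩ := ht
            exact mk_mem_product (mk_mem_product (hGC _ (hmem u hu).1) (hGC _ (hmem u hu).2.1))
              (mk_mem_product (hGB _ (hmem v hv).1) (hGA _ (hmem w hw).2.1))
          · rintro ⟨v, u, w⟩ ht ⟨v', u', w'⟩ ht' heq
            simp only [coe_sigma, Set.mem_sigma_iff, mem_coe, mem_product, mem_filter] at ht ht'
            obtain ⟨hv, ⟨hu, huv⟩, hw, hwv⟩ := ht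
            obtain ⟨hv', ⟨hu', huv'⟩, hw', hwv'⟩ := ht'
            have mv := (hmem v hv).2.2
            have mu := (hmem u hu).2.2
            obtain ⟨mw1, -, mw⟩ := hmem w hw
            have mv' := (hmem v' hv').2.2
            have mu' := (hmem u' hu').2.2
            obtain ⟨mw1', -, mw'⟩ := hmem w' hw'
            clear hv hu hw hv' hu' hw'
            obtain ⟨⟨v1, v2⟩, v3, v4⟩ := v
            obtain ⟨⟨u1, u2⟩, u3, u4⟩ := u
            obtain ⟨⟨w1, w2⟩, w3, w4⟩ := w
            obtain ⟨⟨v1', v2'⟩, v3', v4'⟩ := v'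
            obtain ⟨⟨u1', u2'⟩, u3', u4'⟩ := u'
            obtain ⟨⟨w1', w2'⟩, w3', w4'⟩ := w'
            simp only [hf, hg, Prod.mk.injEq] at *
            obtain ⟨rfl, rfl⟩ := huv
            obtain ⟨rfl, hwv⟩ := hwv
            obtain ⟨rfl, rfl⟩ := huv'
            obtain ⟨rfl, hwv'⟩ := hwv'
            obtain ⟨⟨e1, e2⟩, rfl, rfl⟩ := heq
            subst mv mu mw mv' mu' mw'
            have hw : w1 - w4 = w1' - w4' := by
              rw [eq_sub_of_add_eq' hwv, eq_sub_of_add_eq' hwv', eq_sub_of_add_eq e1,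
                eq_sub_of_add_eq e2]
              abel
            obtain ⟨rfl, rfl⟩ := Prod.mk.inj (hinj mw1 mw1' hw)
            obtain rfl := add_left_cancel e1
            obtain rfl := add_right_cancel e2
            rfl
      _ ≤ m ^ 4 := by
          simp only [card_product]
          calc _ ≤ (m * m) * (m * m) := by gcongr
            _ = m ^ 4 := by ring
  have hV3 : #V ^ 3 ≤ m ^ 8 := by
    refine hchain.trans ?_
    simp only [card_product]
    calc _ ≤ m ^ 4 * (m * m) * (m * m) := by gcongr
      _ = m ^ 8 := by ring
  calc #G ^ 6 = (#G ^ 2) ^ 3 := by ring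
    _ ≤ (#V * m) ^ 3 := by gcongr
    _ = #V ^ 3 * m ^ 3 := by ring
    _ ≤ m ^ 8 * m ^ 3 := by gcongr
    _ = m ^ 11 := by ring

/-- If every point of `T` is a vertex of a possibly degenerate square whose other three vertices
lie in `S`, then `#T ≤ #S ^ (11 / 6)`. -/
theorem card_pow_six_le_of_forall_exists_square (S T : Finset (ℤ × ℤ))
    (h : ∀ a ∈ T, ∃ d : ℤ × ℤ,
      a + d ∈ S ∧ a + (-d.2, d.1) ∈ S ∧ a + d + (-d.2, d.1) ∈ S) :
    #T ^ 6 ≤ #S ^ 11 := by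
  choose! d hd using h
  set X : ℤ × ℤ → ℤ × ℤ := fun p => (p.1 - p.2, p.1 + p.2) with hX
  set Y : ℤ × ℤ → ℤ × ℤ := fun p => (p.1 + p.2, p.2 - p.1) with hY
  set φ : ℤ × ℤ → (ℤ × ℤ) × (ℤ × ℤ) := fun a =>
    (X (a + d a), Y (a + (-(d a).2, (d a).1))) with hφ
  have hsub : ∀ a, (φ a).1 - (φ a).2 = (-2 * a.2, 2 * a.1) := fun a => by
    ext <;> simp [hφ, hX, hY] <;> ring
  have hadd : ∀ a, (φ a).1 + (φ a).2 = 2 • (a + d a + (-(d a).2, (d a).1)) := fun a => by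
    ext <;> simp [hφ, hX, hY] <;> ring
  have hrot : ∀ a b : ℤ × ℤ, (φ a).1 - (φ a).2 = (φ b).1 - (φ b).2 → a = b := fun a b hab => by
    rw [hsub, hsub, Prod.mk.injEq] at hab
    ext <;> linarith [hab.1, hab.2]
  rw [← card_image_of_injective T (f := φ) fun a b hab => hrot a b (by rw [hab])]
  refine card_pow_six_le_of_injOn_sub_s7 _ (S.image X) (S.image Y) (S.image (2 • ·)) _
    card_image_le card_image_le card_image_le ?_ ?_ ?_ ?_
  · exact forall_mem_image.2 fun a ha => mem_image_of_mem X (hd a ha).1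
  · exact forall_mem_image.2 fun a ha => mem_image_of_mem Y (hd a ha).2.1
  · refine forall_mem_image.2 fun a ha => ?_
    rw [hadd]
    exact mem_image_of_mem (2 • ·) (hd a ha).2.2
  · intro p hp q hq hpq
    obtain ⟨a, -, rfl⟩ := mem_image.1 hp
    obtain ⟨b, -, rfl⟩ := mem_image.1 hq
    rw [hrot a b hpq]


/-- If `S ⊆ [n] × [n] ⊂ ℤ²` is such that every grid point `a ∉ S` forms a
(tilted) square `a, a + d, a + d⊥, a + d + d⊥` (`d ≠ 0`, `d⊥ = (-d₂, d₁)`)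
with three elements of `S`, then `|S| ≥ n^(12/11) - ε·n` for `n` large. -/
theorem square_saturated_grid_lower_bound :
    ∀ ε : ℝ, 0 < ε → ∃ N₀ : ℕ, ∀ n : ℕ, N₀ ≤ n →
      ∀ S : Finset (ℤ × ℤ),
        S ⊆ Finset.Ico (0 : ℤ) (n : ℤ) ×ˢ Finset.Ico (0 : ℤ) (n : ℤ) →
        (∀ a : ℤ × ℤ,
          a ∈ Finset.Ico (0 : ℤ) (n : ℤ) ×ˢ Finset.Ico (0 : ℤ) (n : ℤ) → a ∉ S →
          ∃ d : ℤ × ℤ, d ≠ 0 ∧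
            a + d ∈ S ∧ a + (-d.2, d.1) ∈ S ∧ a + d + (-d.2, d.1) ∈ S) →
        (n : ℝ) ^ ((12 : ℝ) / 11) - ε * (n : ℝ) ≤ (S.card : ℝ) := by
  intro ε hε
  refine ⟨0, fun n _ S _ hS => ?_⟩
  have hcard := card_pow_six_le_of_forall_exists_square S
    (Finset.Ico (0 : ℤ) n ×ˢ Finset.Ico (0 : ℤ) n) fun a ha => by
      by_cases haS : a ∈ S
      · exact ⟨0, by simp [haS, ← Prod.zero_eq_mk]⟩
      · obtain ⟨d, -, hd⟩ := hS a ha haS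
        exact ⟨d, hd⟩
  rw [card_product, Int.card_Ico, sub_zero, Int.toNat_natCast] at hcard
  have hpow : ((n : ℝ) ^ ((12 : ℝ) / 11)) ^ 11 ≤ (#S : ℝ) ^ 11 := by
    rw [← Real.rpow_natCast, ← Real.rpow_mul n.cast_nonneg]
    norm_num
    exact_mod_cast (show n ^ 12 = (n * n) ^ 6 by ring) ▸ hcard
  have hle := le_of_pow_le_pow_left₀ (by norm_num) (Nat.cast_nonneg _) hpow
  have : 0 ≤ ε * n := by positivity
  linarith
end

section
/- There exist constants c₁ > 0, C > 0 and a threshold N₀ such that for every n ≥ N₀, every set A ⊆ [n] × [n] ⊂ ℤ² containing no isosceles right triangle satisfies |A| ≤ C·n²/(log n)^{c₁}. -/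
namespace RightTriangle

open Finset

section Fourier
variable {G : Type*} [AddCommGroup G] [Fintype G]

/-- The unnormalised Fourier transform of a real function on a finite abelian group. -/
noncomputable def dft (f : G → ℝ) (ψ : AddChar G ℂ) : ℂ := ∑ x, (f x : ℂ) * ψ x

lemma dft_add (f g : G → ℝ) (ψ : AddChar G ℂ) : dft (f + g) ψ = dft f ψ + dft g ψ := by
  simp [dft, add_mul, sum_add_distrib]

lemma norm_dft_le (f : G → ℝ) (ψ : AddChar G ℂ) : ‖dft f ψ‖ ≤ ∑ x, |f x| := by
  refine (norm_sum_le _ _).trans (sum_le_sum fun x _ ↦ ?_)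
  simp

lemma dft_inv (f : G → ℝ) (ψ : AddChar G ℂ) :
    dft f ψ⁻¹ = (starRingEnd ℂ) (dft f ψ) := by
  simp [dft, AddChar.map_neg_eq_conj, AddChar.inv_apply]

/-- Parseval's identity. -/
lemma sum_norm_dft_sq (f : G → ℝ) :
    ∑ ψ : AddChar G ℂ, ‖dft f ψ‖ ^ 2 = Fintype.card G * ∑ x, f x ^ 2 := by
  classical
  have h : ∀ ψ : AddChar G ℂ, ((‖dft f ψ‖ ^ 2 : ℝ) : ℂ)
      = ∑ x, ∑ y, (f x : ℂ) * f y * ψ (x - y) := by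
    intro ψ
    rw [Complex.ofReal_pow, ← Complex.mul_conj', ← dft_inv]
    simp only [dft, sum_mul_sum]
    refine sum_congr rfl fun x _ ↦ sum_congr rfl fun y _ ↦ ?_
    rw [sub_eq_add_neg, AddChar.map_add_eq_mul, AddChar.inv_apply]
    ring
  apply Complex.ofReal_injective
  rw [Complex.ofReal_sum]
  simp only [h]
  rw [sum_comm]
  simp only [sum_comm (s := (univ : Finset (AddChar G ℂ))), ← mul_sum,
    AddChar.sum_apply_eq_ite, sub_eq_zero]
  simp [mul_sum]
  exact sum_congr rfl fun x _ ↦ by ring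

/-- The Fourier transform of the sum of the translates of `f` along a finite family. -/
lemma dft_sum_translate {κ : Type*} (P : Finset κ) (s : κ → G) (f : G → ℝ) (ψ : AddChar G ℂ) :
    dft (fun x ↦ ∑ p ∈ P, f (x + s p)) ψ = (∑ p ∈ P, ψ (-s p)) * dft f ψ := by
  simp only [dft, Complex.ofReal_sum, sum_mul]
  rw [sum_comm]
  refine sum_congr rfl fun p _ ↦ ?_
  rw [mul_sum, ← Equiv.sum_comp (Equiv.addRight (s p)) (fun x ↦ ψ (-s p) * ((f x : ℂ) * ψ x))]
  refine sum_congr rfl fun x _ ↦ ?_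
  simp only [Equiv.coe_addRight]
  have : ψ x = ψ (-s p) * ψ (x + s p) := by
    rw [← AddChar.map_add_eq_mul]; congr 1; abel
  rw [this]; ring

/-- The trilinear form counting solutions of `c = φ a + ι b`. -/
def tri (φ ι : G →+ G) (f : G → ℝ) : ℝ := ∑ a, ∑ b, f a * f b * f (φ a + ι b)

lemma card_mul_tri (φ ι : G →+ G) (f : G → ℝ) :
    ((Fintype.card G * tri φ ι f : ℝ) : ℂ)
      = ∑ ψ : AddChar G ℂ, dft f (ψ.compAddMonoidHom φ) * dft f (ψ.compAddMonoidHom ι)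
          * dft f ψ⁻¹ := by
  classical
  have h : ∀ ψ : AddChar G ℂ, dft f (ψ.compAddMonoidHom φ) * dft f (ψ.compAddMonoidHom ι)
          * dft f ψ⁻¹ = ∑ a, ∑ b, ∑ c, (f a * f b * f c : ℂ) * ψ (φ a + ι b - c) := by
    intro ψ
    rw [dft, dft, dft, sum_mul_sum, sum_mul]
    refine sum_congr rfl fun a _ ↦ ?_
    rw [sum_mul]
    refine sum_congr rfl fun b _ ↦ ?_
    rw [mul_sum]
    refine sum_congr rfl fun c _ ↦ ?_
    rw [sub_eq_add_neg, AddChar.map_add_eq_mul, AddChar.map_add_eq_mul, AddChar.inv_apply]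
    simp only [AddChar.compAddMonoidHom_apply]
    ring
  simp only [h]
  rw [sum_comm]
  simp only [sum_comm (s := (univ : Finset (AddChar G ℂ))), ← mul_sum,
    AddChar.sum_apply_eq_ite, sub_eq_zero]
  simp [tri, mul_sum]
  exact sum_congr rfl fun a _ ↦ sum_congr rfl fun b _ ↦ by ring

lemma mul_mul_le_sum_cubes {x y z : ℝ} (hx : 0 ≤ x) (hy : 0 ≤ y) (hz : 0 ≤ z) :
    x * y * z ≤ (x ^ 3 + y ^ 3 + z ^ 3) / 3 := by
  nlinarith [mul_nonneg (add_nonneg (add_nonneg hx hy) hz)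
    (add_nonneg (add_nonneg (sq_nonneg (x - y)) (sq_nonneg (y - z))) (sq_nonneg (z - x)))]

lemma add_cube_le {x y : ℝ} (hx : 0 ≤ x) (hy : 0 ≤ y) : (x + y) ^ 3 ≤ 4 * (x ^ 3 + y ^ 3) := by
  nlinarith [mul_nonneg (add_nonneg hx hy) (sq_nonneg (x - y))]

lemma norm_prod_add_sub_prod_le {κ : ℝ} (hκ : 0 < κ) (hκ1 : κ ≤ 1) (g₁ g₂ g₃ f₁ f₂ f₃ : ℂ) :
    ‖(g₁ + f₁) * (g₂ + f₂) * (g₃ + f₃) - g₁ * g₂ * g₃‖ ≤ 4 * κ / 3 *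
      ((‖g₁‖ ^ 3 + ‖g₂‖ ^ 3 + ‖g₃‖ ^ 3) + (‖f₁‖ ^ 3 + ‖f₂‖ ^ 3 + ‖f₃‖ ^ 3) / κ ^ 3) := by
  have key : ∀ a b c x y z : ℝ, 0 ≤ a → 0 ≤ b → 0 ≤ c → 0 ≤ x → 0 ≤ y → 0 ≤ z →
      a * b * (κ * z) + a * (κ * y) * c + a * (κ * y) * (κ * z) + (κ * x) * b * c
        + (κ * x) * b * (κ * z) + (κ * x) * (κ * y) * c + (κ * x) * (κ * y) * (κ * z)
      ≤ 4 * κ / 3 * ((a ^ 3 + b ^ 3 + c ^ 3) + (x ^ 3 + y ^ 3 + z ^ 3)) := by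
    intro a b c x y z ha hb hc hx hy hz
    have h1 := mul_mul_le_sum_cubes (add_nonneg ha hx) (add_nonneg hb hy) (add_nonneg hc hz)
    have h2 := add_cube_le ha hx
    have h3 := add_cube_le hb hy
    have h4 := add_cube_le hc hz
    have h5 : (a + x) * (b + y) * (c + z) ≤
        4 / 3 * ((a ^ 3 + b ^ 3 + c ^ 3) + (x ^ 3 + y ^ 3 + z ^ 3)) := by linarith
    have h6 := mul_le_mul_of_nonneg_left h5 hκ.le
    have hk2 : κ * κ ≤ κ := by nlinarith
    have hk3 : κ * κ * κ ≤ κ := by nlinarith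
    have e1 := mul_le_mul_of_nonneg_right hk2 (by positivity : 0 ≤ a * y * z)
    have e2 := mul_le_mul_of_nonneg_right hk2 (by positivity : 0 ≤ x * b * z)
    have e3 := mul_le_mul_of_nonneg_right hk2 (by positivity : 0 ≤ x * y * c)
    have e4 := mul_le_mul_of_nonneg_right hk3 (by positivity : 0 ≤ x * y * z)
    have e5 : 0 ≤ κ * (a * b * c) := by positivity
    linarith
  have hdiv : ∀ t : ℝ, κ * (t / κ) = t := fun t ↦ by field_simp
  have h := key ‖g₁‖ ‖g₂‖ ‖g₃‖ (‖f₁‖ / κ) (‖f₂‖ / κ) (‖f₃‖ / κ) (norm_nonneg _) (norm_nonneg _)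
    (norm_nonneg _) (by positivity) (by positivity) (by positivity)
  simp only [hdiv, div_pow, ← add_div] at h
  refine le_trans ?_ h
  have e : (g₁ + f₁) * (g₂ + f₂) * (g₃ + f₃) - g₁ * g₂ * g₃ = g₁ * g₂ * f₃ + g₁ * f₂ * g₃
      + g₁ * f₂ * f₃ + f₁ * g₂ * g₃ + f₁ * g₂ * f₃ + f₁ * f₂ * g₃ + f₁ * f₂ * f₃ := by ring
  rw [e]
  refine (norm_add_le _ _).trans (add_le_add ?_ (by simp))
  refine (norm_add_le _ _).trans (add_le_add ?_ (by simp))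
  refine (norm_add_le _ _).trans (add_le_add ?_ (by simp))
  refine (norm_add_le _ _).trans (add_le_add ?_ (by simp))
  refine (norm_add_le _ _).trans (add_le_add ?_ (by simp))
  refine (norm_add_le _ _).trans (add_le_add (by simp) (by simp))

lemma sum_compAddMonoidHom {φ : G →+ G} (hφ : Function.Surjective φ) (F : AddChar G ℂ → ℝ) :
    ∑ ψ : AddChar G ℂ, F (ψ.compAddMonoidHom φ) = ∑ ψ, F ψ := by
  refine Function.Bijective.sum_comp (Finite.injective_iff_bijective.1 fun ψ χ h ↦ ?_) F
  ext x
  obtain ⟨y, rfl⟩ := hφ x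
  simpa using DFunLike.congr_fun h y

lemma card_mul_abs_tri_sub_le {φ ι : G →+ G} (hφ : Function.Surjective φ)
    (hι : Function.Surjective ι) {κ R : ℝ} (hκ : 0 < κ) (hκ1 : κ ≤ 1) (g f : G → ℝ)
    (hg : ∑ ψ, ‖dft g ψ‖ ^ 3 ≤ R) (hf : ∑ ψ, ‖dft f ψ‖ ^ 3 ≤ κ ^ 3 * R) :
    Fintype.card G * |tri φ ι (g + f) - tri φ ι g| ≤ 8 * κ * R := by
  have hinv : ∀ F : AddChar G ℂ → ℝ, ∑ ψ, F ψ⁻¹ = ∑ ψ, F ψ := fun F ↦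
    Equiv.sum_comp (Equiv.inv (AddChar G ℂ)) F
  have h1 : Fintype.card G * |tri φ ι (g + f) - tri φ ι g|
      = ‖((Fintype.card G * tri φ ι (g + f) : ℝ) : ℂ) - ((Fintype.card G * tri φ ι g : ℝ) : ℂ)‖ := by
    rw [← Complex.ofReal_sub, Complex.norm_real, ← mul_sub, norm_mul]
    simp
  rw [h1, card_mul_tri, card_mul_tri, ← sum_sub_distrib]
  refine (norm_sum_le _ _).trans ?_
  simp only [dft_add]
  refine (sum_le_sum fun ψ _ ↦ norm_prod_add_sub_prod_le hκ hκ1 _ _ _ _ _ _).trans ?_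
  rw [← mul_sum, sum_add_distrib, ← sum_div]
  simp only [sum_add_distrib]
  rw [sum_compAddMonoidHom hφ (fun ψ ↦ ‖dft g ψ‖ ^ 3),
    sum_compAddMonoidHom hι (fun ψ ↦ ‖dft g ψ‖ ^ 3), hinv (fun ψ ↦ ‖dft g ψ‖ ^ 3),
    sum_compAddMonoidHom hφ (fun ψ ↦ ‖dft f ψ‖ ^ 3),
    sum_compAddMonoidHom hι (fun ψ ↦ ‖dft f ψ‖ ^ 3), hinv (fun ψ ↦ ‖dft f ψ‖ ^ 3)]
  have h2 : (∑ ψ, ‖dft f ψ‖ ^ 3) / κ ^ 3 ≤ R := by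
    rw [div_le_iff₀ (by positivity)]; linarith
  have h3 : (∑ ψ, ‖dft f ψ‖ ^ 3 + ∑ ψ, ‖dft f ψ‖ ^ 3 + ∑ ψ, ‖dft f ψ‖ ^ 3) / κ ^ 3 ≤ 3 * R := by
    rw [add_div, add_div]; linarith
  calc _ ≤ 4 * κ / 3 * ((R + R + R) + 3 * R) := by gcongr
    _ = 8 * κ * R := by ring

end Fourier

section Concentration

/-- A finite family whose cubes have large sum has a subfamily whose squares have large sum
relative to a power of its size. -/
lemma exists_large_sq_sum : ∃ c : ℝ, 0 < c ∧ ∀ {α : Type} (T : Finset α) (v : α → ℝ) (τ : ℝ),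
    (∀ i, 0 ≤ v i) → 0 < τ → τ ^ 3 < ∑ i ∈ T, v i ^ 3 →
    ∃ S ⊆ T, S.Nonempty ∧ c * τ ^ 2 * (#S : ℝ) ^ (1 / 4 : ℝ) ≤ ∑ i ∈ S, v i ^ 2 := by
  classical
  have hsum : Summable fun k : ℕ ↦ 1 / (k : ℝ) ^ (9 / 8 : ℝ) :=
    Real.summable_one_div_nat_rpow.2 (by norm_num)
  set Z : ℝ := ∑' k : ℕ, 1 / (k : ℝ) ^ (9 / 8 : ℝ) with hZ
  have hZ0 : 0 ≤ Z := tsum_nonneg fun k ↦ by positivity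
  set c : ℝ := (1 + Z)⁻¹ with hc
  have hc0 : 0 < c := by positivity
  have hc1 : c ≤ 1 := inv_le_one_of_one_le₀ (by linarith)
  refine ⟨c, hc0, fun {α} T v τ hv hτ hT ↦ ?_⟩
  by_contra! hcon
  have key : ∀ S ⊆ T, ∑ i ∈ S, v i ^ 3
      ≤ c * τ ^ 3 * ∑ k ∈ range (#S + 1), 1 / (k : ℝ) ^ (9 / 8 : ℝ) := by
    intro S
    induction hn : #S generalizing S with
    | zero =>
      intro _
      rw [card_eq_zero.1 hn]
      simp
    | succ n ih =>
      intro hS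
      have hne : S.Nonempty := card_pos.1 (by omega)
      obtain ⟨x, hx, hmin⟩ := exists_min_image S v hne
      have h1 := ih (S.erase x) (by rw [card_erase_of_mem hx]; omega)
        ((erase_subset _ _).trans hS)
      rw [← add_sum_erase S _ hx, sum_range_succ]
      have h2 : (#S : ℝ) * v x ^ 2 ≤ ∑ i ∈ S, v i ^ 2 := by
        rw [← nsmul_eq_mul]
        exact card_nsmul_le_sum _ _ _ fun i hi ↦ pow_le_pow_left₀ (hv x) (hmin i hi) 2
      have h3 := (h2.trans_lt (hcon S hS hne)).le
      rw [hn] at h3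
      set m : ℝ := ((n + 1 : ℕ) : ℝ) with hm
      have hm0 : 0 < m := by positivity
      set r : ℝ := m ^ (1 / 8 : ℝ) with hr
      have hr0 : 0 < r := Real.rpow_pos_of_pos hm0 _
      have e1 : m ^ (1 / 4 : ℝ) = r ^ 2 := by
        rw [hr, ← Real.rpow_natCast, ← Real.rpow_mul hm0.le]; norm_num
      have e2 : m ^ (9 / 8 : ℝ) = r ^ 9 := by
        rw [hr, ← Real.rpow_natCast, ← Real.rpow_mul hm0.le]; norm_num
      have e3 : m = r ^ 8 := by
        rw [hr, ← Real.rpow_natCast, ← Real.rpow_mul hm0.le]; norm_num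
      rw [e1, e3] at h3
      have h4 : (r ^ 3 * v x) ^ 2 ≤ c * τ ^ 2 := by
        have : r ^ 2 * ((r ^ 3 * v x) ^ 2) ≤ r ^ 2 * (c * τ ^ 2) := by nlinarith
        exact le_of_mul_le_mul_left this (by positivity)
      have h5 : r ^ 3 * v x ≤ τ := by
        refine le_of_sq_le_sq ?_ hτ.le
        nlinarith [sq_nonneg τ]
      have h6 : v x ^ 3 ≤ c * τ ^ 3 * (1 / m ^ (9 / 8 : ℝ)) := by
        rw [e2, mul_one_div, le_div_iff₀ (by positivity)]
        calc v x ^ 3 * r ^ 9 = (r ^ 3 * v x) ^ 2 * (r ^ 3 * v x) := by ring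
          _ ≤ (c * τ ^ 2) * τ := mul_le_mul h4 h5 (mul_nonneg (by positivity) (hv x)) (by positivity)
          _ = _ := by ring
      rw [mul_add]
      linarith
  have h := key T subset_rfl
  have h2 : ∑ k ∈ range (#T + 1), 1 / (k : ℝ) ^ (9 / 8 : ℝ) ≤ Z :=
    hsum.sum_le_tsum _ fun k _ ↦ by positivity
  have h3 : c * τ ^ 3 * Z ≤ τ ^ 3 := by
    have : c * Z ≤ 1 := by
      rw [hc, inv_mul_le_iff₀ (by positivity)]; linarith
    nlinarith [pow_pos hτ 3]
  have h4 : c * τ ^ 3 * ∑ k ∈ range (#T + 1), 1 / (k : ℝ) ^ (9 / 8 : ℝ) ≤ c * τ ^ 3 * Z := by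
    gcongr
  linarith

/-- Simultaneous approximation: finitely many points of the unit circle have a common small
power close to `1`. -/
lemma exists_pow_near_one {κ : Type*} [Fintype κ] (z : κ → ℂ) (hz : ∀ k, ‖z k‖ = 1) {H : ℕ}
    (hH : 0 < H) :
    ∃ q : ℕ, 0 < q ∧ q ≤ (2 * H + 1) ^ (2 * Fintype.card κ) ∧ ∀ k, ‖z k ^ q - 1‖ ≤ 2 / H := by
  classical
  set I : Finset ℤ := Icc (-(H : ℤ)) H with hI
  have hIc : #I = 2 * H + 1 := by rw [hI, Int.card_Icc]; omega
  set box : ℕ → κ → ℤ × ℤ := fun q k ↦ (⌊H * (z k ^ q).re⌋, ⌊H * (z k ^ q).im⌋) with hbox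
  set T : Finset (κ → ℤ × ℤ) := Fintype.piFinset fun _ ↦ I ×ˢ I with hT
  have hTc : #T = (2 * H + 1) ^ (2 * Fintype.card κ) := by
    rw [hT, Fintype.card_piFinset]
    simp [hIc, pow_mul, sq]
  have hHr : (0 : ℝ) < H := by exact_mod_cast hH
  have hfl : ∀ t : ℝ, |t| ≤ 1 → ⌊H * t⌋ ∈ I := by
    intro t ht
    rw [abs_le] at ht
    rw [hI, mem_Icc]
    constructor
    · rw [Int.le_floor]; push_cast; nlinarith
    · rw [← Int.cast_le (R := ℝ)]
      refine (Int.floor_le _).trans ?_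
      push_cast; nlinarith
  have hmaps : Set.MapsTo box (range (#T + 1) : Finset ℕ) T := by
    intro q _
    rw [mem_coe, hT, Fintype.mem_piFinset]
    intro k
    have h1 : ‖z k ^ q‖ = 1 := by rw [norm_pow, hz, one_pow]
    exact mem_product.2 ⟨hfl _ ((Complex.abs_re_le_norm _).trans h1.le),
      hfl _ ((Complex.abs_im_le_norm _).trans h1.le)⟩
  obtain ⟨a, ha, b, hb, hab, heq⟩ := exists_ne_map_eq_of_card_lt_of_maps_to (by simp) hmaps
  have hfl2 : ∀ s t : ℝ, ⌊H * s⌋ = ⌊H * t⌋ → |s - t| ≤ 1 / H := by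
    intro s t h
    have h1 := Int.abs_sub_lt_one_of_floor_eq_floor h
    rw [← mul_sub, abs_mul, abs_of_pos hHr] at h1
    rw [le_div_iff₀ hHr]; linarith
  have close : ∀ k, ‖z k ^ a - z k ^ b‖ ≤ 2 / H := by
    intro k
    have h := congrFun heq k
    simp only [hbox, Prod.mk.injEq] at h
    refine (Complex.norm_le_abs_re_add_abs_im _).trans ?_
    have h1 := hfl2 _ _ h.1
    have h2 := hfl2 _ _ h.2
    rw [Complex.sub_re, Complex.sub_im]
    calc _ ≤ 1 / (H : ℝ) + 1 / H := add_le_add h1 h2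
      _ = _ := by ring
  have main : ∀ a b : ℕ, a < b → b < #T + 1 → (∀ k, ‖z k ^ a - z k ^ b‖ ≤ 2 / H) →
      ∃ q : ℕ, 0 < q ∧ q ≤ (2 * H + 1) ^ (2 * Fintype.card κ) ∧ ∀ k, ‖z k ^ q - 1‖ ≤ 2 / H := by
    intro a b hlt hb h
    refine ⟨b - a, by omega, by omega, fun k ↦ ?_⟩
    have e : z k ^ a - z k ^ b = z k ^ a * (1 - z k ^ (b - a)) := by
      rw [mul_sub, mul_one, ← pow_add]; congr 2; omega
    have h1 := h k
    rw [e, norm_mul, norm_pow, hz, one_pow, one_mul, norm_sub_rev] at h1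
    exact h1
  rcases lt_or_gt_of_ne hab with h | h
  · exact main a b h (by simpa using hb) close
  · exact main b a h (by simpa using ha) fun k ↦ by rw [norm_sub_rev]; exact close k

lemma norm_pow_sub_one_le {w : ℂ} (hw : ‖w‖ = 1) (u : ℕ) : ‖w ^ u - 1‖ ≤ u * ‖w - 1‖ := by
  induction u with
  | zero => simp
  | succ u ih =>
    have : w ^ (u + 1) - 1 = w ^ u * (w - 1) + (w ^ u - 1) := by ring
    rw [this]
    refine (norm_add_le _ _).trans ?_
    rw [norm_mul, norm_pow, hw, one_pow]
    push_cast
    linarith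

end Concentration

section Increment
variable {G : Type*}

/-- The real-valued indicator function of a finite set. -/
def ind [DecidableEq G] (A : Finset G) (x : G) : ℝ := if x ∈ A then 1 else 0

lemma ind_nonneg [DecidableEq G] (A : Finset G) (x : G) : 0 ≤ ind A x := by
  unfold ind; split_ifs <;> norm_num

lemma ind_le_one [DecidableEq G] (A : Finset G) (x : G) : ind A x ≤ 1 := by
  unfold ind; split_ifs <;> norm_num

lemma sum_ind [Fintype G] [DecidableEq G] (A : Finset G) : ∑ x, ind A x = #A := by
  simp [ind]

variable [AddCommGroup G] [Fintype G]

lemma sum_translate (F : G → ℝ) (t : G) : ∑ x, F (x + t) = ∑ x, F x :=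
  Equiv.sum_comp (Equiv.addRight t) F

lemma sum_sq_translate_le [DecidableEq G] {κ : Type*} (P : Finset κ) (s : κ → G) {A B : Finset G}
    (hAB : A ⊆ B) {δ m e : ℝ} (hδ : 0 ≤ δ) (hA : (#A : ℝ) = δ * #B)
    (hm : ∀ x, (#{p ∈ P | x + s p ∈ A} : ℝ) ≤ m)
    (he : ∀ p ∈ P, ∀ p' ∈ P, (#{b ∈ B | b + (s p' - s p) ∉ B} : ℝ) ≤ e) :
    ∑ x, (∑ p ∈ P, (ind A (x + s p) - δ * ind B (x + s p))) ^ 2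
      ≤ #P * (m * δ * #B - δ ^ 2 * #P * #B + 2 * δ * #P * e) := by
  set a : G → ℝ := fun x ↦ ∑ p ∈ P, ind A (x + s p) with ha
  set b : G → ℝ := fun x ↦ ∑ p ∈ P, ind B (x + s p) with hb
  have ha0 : ∀ x, 0 ≤ a x := fun x ↦ sum_nonneg fun _ _ ↦ ind_nonneg _ _
  have hb0 : ∀ x, 0 ≤ b x := fun x ↦ sum_nonneg fun _ _ ↦ ind_nonneg _ _
  have ham : ∀ x, a x ≤ m := by
    intro x
    refine le_trans (le_of_eq ?_) (hm x)
    simp [ha, ind]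
  have hbm : ∀ x, b x ≤ #P := by
    intro x
    refine (sum_le_sum fun p _ ↦ ind_le_one B _).trans (by simp)
  have hsa : ∑ x, a x = #P * #A := by
    rw [ha, sum_comm]
    simp [sum_translate (ind A), sum_ind]
  have hsb : ∑ x, b x = #P * #B := by
    rw [hb, sum_comm]
    simp [sum_translate (ind B), sum_ind]
  have h1 : ∑ x, a x ^ 2 ≤ m * (#P * #A) := by
    rw [← hsa, mul_sum]
    exact sum_le_sum fun x _ ↦ by nlinarith [ha0 x, ham x]
  have h2 : ∑ x, b x ^ 2 ≤ #P * (#P * #B) := by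
    rw [← hsb, mul_sum]
    exact sum_le_sum fun x _ ↦ by nlinarith [hb0 x, hbm x]
  have h3 : (#P : ℝ) * (#P * (#A - e)) ≤ ∑ x, a x * b x := by
    have e1 : ∑ x, a x * b x
        = ∑ p ∈ P, ∑ p' ∈ P, ∑ x, ind A x * ind B (x + (s p' - s p)) := by
      simp only [ha, hb, sum_mul_sum]
      rw [sum_comm]
      refine sum_congr rfl fun p _ ↦ ?_
      rw [sum_comm]
      refine sum_congr rfl fun p' _ ↦ ?_
      rw [← sum_translate (fun x ↦ ind A x * ind B (x + (s p' - s p))) (s p)]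
      refine sum_congr rfl fun x _ ↦ ?_
      congr 2
      abel
    rw [e1, ← nsmul_eq_mul, ← nsmul_eq_mul]
    refine card_nsmul_le_sum _ _ _ fun p hp ↦ card_nsmul_le_sum _ _ _ fun p' hp' ↦ ?_
    have e2 : (#A : ℝ) ≤ ∑ x, ind A x * ind B (x + (s p' - s p))
        + #{b ∈ B | b + (s p' - s p) ∉ B} := by
      rw [← sum_ind A, ← sum_ind, ← sum_add_distrib]
      refine sum_le_sum fun x _ ↦ ?_
      by_cases hx : x ∈ A
      · by_cases hx' : x + (s p' - s p) ∈ B <;> simp [ind, hx, hx', hAB hx]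
      · simp only [ind, hx, if_false, zero_mul, zero_add]
        split_ifs <;> norm_num
    linarith [he p hp p' hp']
  have h4 : ∑ x, (∑ p ∈ P, (ind A (x + s p) - δ * ind B (x + s p))) ^ 2
      = ∑ x, a x ^ 2 - 2 * δ * ∑ x, a x * b x + δ ^ 2 * ∑ x, b x ^ 2 := by
    rw [mul_sum, mul_sum, ← sum_sub_distrib, ← sum_add_distrib]
    refine sum_congr rfl fun x _ ↦ ?_
    rw [sum_sub_distrib, ← mul_sum]
    ring
  rw [h4]
  have h5 := mul_le_mul_of_nonneg_left h3 (by positivity : 0 ≤ 2 * δ)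
  have h6 := mul_le_mul_of_nonneg_left h2 (by positivity : 0 ≤ δ ^ 2)
  rw [hA] at h1 h5
  linarith

lemma sum_norm_dft_sq_le {κ : Type*} (P : Finset κ) (s : κ → G) (f : G → ℝ)
    (S : Finset (AddChar G ℂ)) (hS : ∀ ψ ∈ S, (#P : ℝ) / 2 ≤ ‖∑ p ∈ P, ψ (-s p)‖) :
    (#P : ℝ) ^ 2 / 4 * ∑ ψ ∈ S, ‖dft f ψ‖ ^ 2
      ≤ Fintype.card G * ∑ x, (∑ p ∈ P, f (x + s p)) ^ 2 := by
  rw [← sum_norm_dft_sq, mul_sum]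
  refine le_trans ?_ (sum_le_univ_sum_of_nonneg (s := S) fun ψ ↦ by positivity)
  refine sum_le_sum fun ψ hψ ↦ ?_
  rw [dft_sum_translate, norm_mul, mul_pow]
  have := pow_le_pow_left₀ (by positivity) (hS ψ hψ) 2
  refine mul_le_mul_of_nonneg_right ?_ (by positivity)
  linarith

/-- Finitely many characters are simultaneously almost constant on a dilated square grid. -/
lemma exists_dilate (g₁ g₂ : G) (S : Finset (AddChar G ℂ)) {L : ℕ} (hL : 0 < L) :
    ∃ q : ℕ, 0 < q ∧ q ≤ (16 * L + 1) ^ (4 * #S) ∧ ∀ ψ ∈ S,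
      (#(range L ×ˢ range L) : ℝ) / 2
        ≤ ‖∑ p ∈ range L ×ˢ range L, ψ (-((q * p.1) • g₁ + (q * p.2) • g₂))‖ := by
  have hnorm : ∀ (ψ : AddChar G ℂ) x, ‖ψ x‖ = 1 := fun ψ x ↦ by simp
  obtain ⟨q, hq0, hq, hz⟩ := exists_pow_near_one
    (fun k : S × Bool ↦ (k.1 : AddChar G ℂ) (-(if k.2 then g₁ else g₂)))
    (fun k ↦ hnorm _ _) (H := 8 * L) (by omega)
  refine ⟨q, hq0, hq.trans (le_of_eq ?_), fun ψ hψ ↦ ?_⟩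
  · simp only [Fintype.card_prod, Fintype.card_coe, Fintype.card_bool]
    congr 1 <;> ring
  have h1 := hz (⟨ψ, hψ⟩, true)
  have h2 := hz (⟨ψ, hψ⟩, false)
  simp only [if_true, Bool.false_eq_true, if_false] at h1 h2
  set w₁ := ψ (-g₁) ^ q with hw₁
  set w₂ := ψ (-g₂) ^ q with hw₂
  have n1 : ‖w₁‖ = 1 := by rw [hw₁, norm_pow, hnorm, one_pow]
  have n2 : ‖w₂‖ = 1 := by rw [hw₂, norm_pow, hnorm, one_pow]
  have hLr : (0 : ℝ) < L := by exact_mod_cast hL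
  have hterm : ∀ p ∈ range L ×ˢ range L,
      ‖ψ (-((q * p.1) • g₁ + (q * p.2) • g₂)) - 1‖ ≤ 1 / 2 := by
    rintro ⟨u, v⟩ hp
    rw [mem_product, mem_range, mem_range] at hp
    have e : ψ (-((q * u) • g₁ + (q * v) • g₂)) = w₁ ^ u * w₂ ^ v := by
      rw [neg_add, AddChar.map_add_eq_mul, ← smul_neg, ← smul_neg, AddChar.map_nsmul_eq_pow,
        AddChar.map_nsmul_eq_pow, pow_mul, pow_mul]
    have e' : w₁ ^ u * w₂ ^ v - 1 = w₁ ^ u * (w₂ ^ v - 1) + (w₁ ^ u - 1) := by ring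
    rw [e, e']
    refine (norm_add_le _ _).trans ?_
    rw [norm_mul, norm_pow, n1, one_pow, one_mul]
    have b1 := (norm_pow_sub_one_le n1 u).trans
      (mul_le_mul (by exact_mod_cast hp.1.le : (u : ℝ) ≤ L) h1 (norm_nonneg _) hLr.le)
    have b2 := (norm_pow_sub_one_le n2 v).trans
      (mul_le_mul (by exact_mod_cast hp.2.le : (v : ℝ) ≤ L) h2 (norm_nonneg _) hLr.le)
    have b3 : (L : ℝ) * (2 / ((8 * L : ℕ) : ℝ)) = 1 / 4 := by
      push_cast; field_simp; norm_num
    linarith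
  set P := range L ×ˢ range L with hP
  have hsum : ‖∑ p ∈ P, (ψ (-((q * p.1) • g₁ + (q * p.2) • g₂)) - 1)‖ ≤ (#P : ℝ) * (1 / 2) := by
    refine (norm_sum_le_of_le _ hterm).trans ?_
    simp
  rw [sum_sub_distrib] at hsum
  have h3 := norm_sub_norm_le (∑ p ∈ P, (1 : ℂ))
    (∑ p ∈ P, ψ (-((q * p.1) • g₁ + (q * p.2) • g₂)))
  rw [norm_sub_rev] at h3
  have h4 : ‖∑ p ∈ P, (1 : ℂ)‖ = #P := by simp
  linarith

end Increment

section Triangles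

/-- `A` contains no isosceles right triangle `x, x + y, x + y⊥` with `y ≠ 0`. -/
def TriangleFree {R : Type*} [Ring R] (A : Finset (R × R)) : Prop :=
  ¬ ∃ x y : R × R, y ≠ 0 ∧ x ∈ A ∧ x + y ∈ A ∧ x + (-y.2, y.1) ∈ A

/-- The square grid of side `n`. -/
noncomputable def square (n : ℕ) : Finset (ℤ × ℤ) := Ico (0 : ℤ) n ×ˢ Ico (0 : ℤ) n

lemma mem_square {n : ℕ} {p : ℤ × ℤ} :
    p ∈ square n ↔ (0 ≤ p.1 ∧ p.1 < n) ∧ (0 ≤ p.2 ∧ p.2 < n) := by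
  simp [square]

lemma card_square (n : ℕ) : #(square n) = n ^ 2 := by
  simp [square, sq]

variable {M : ℕ}

/-- Coordinatewise reduction modulo `M`. -/
def red (M : ℕ) (p : ℤ × ℤ) : ZMod M × ZMod M := (p.1, p.2)

/-- Coordinatewise reduction modulo `M` of a finite set. -/
def redSet (M : ℕ) (A : Finset (ℤ × ℤ)) : Finset (ZMod M × ZMod M) := A.image (red M)

lemma red_add (p r : ℤ × ℤ) : red M (p + r) = red M p + red M r := by
  simp [red]

lemma eq_zero_of_cast_eq_zero {a : ℤ} (ha : |a| < M) (h : (a : ZMod M) = 0) : a = 0 :=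
  Int.eq_zero_of_abs_lt_dvd ((ZMod.intCast_zmod_eq_zero_iff_dvd a M).1 h) ha

lemma eq_of_cast_eq {a b : ℤ} (hab : |a - b| < M) (h : (a : ZMod M) = b) : a = b :=
  sub_eq_zero.1 (eq_zero_of_cast_eq_zero hab (by push_cast; rw [h, sub_self]))

lemma red_injOn {N : ℕ} (hNM : N ≤ M) : Set.InjOn (red M) (square N) := by
  intro p hp r hr h
  rw [mem_coe, mem_square] at hp hr
  simp only [red, Prod.mk.injEq] at h
  ext
  · exact eq_of_cast_eq (by rw [abs_lt]; constructor <;> omega) h.1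
  · exact eq_of_cast_eq (by rw [abs_lt]; constructor <;> omega) h.2

lemma card_redSet {N : ℕ} (hNM : N ≤ M) {A : Finset (ℤ × ℤ)} (hA : A ⊆ square N) :
    #(redSet M A) = #A :=
  card_image_of_injOn ((red_injOn hNM).mono (by exact_mod_cast hA))

/-- Rotation by a right angle. -/
def rot (M : ℕ) : ZMod M × ZMod M →+ ZMod M × ZMod M :=
  AddMonoidHom.mk' (fun x ↦ (-x.2, x.1)) (by intro a b; ext <;> simp; ring)

lemma rot_apply (x : ZMod M × ZMod M) : rot M x = (-x.2, x.1) := rfl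

lemma rot_surjective : Function.Surjective (rot M) :=
  fun x ↦ ⟨(x.2, -x.1), by simp [rot_apply]⟩

/-- The map `x ↦ x - x⊥`. -/
def subRot (M : ℕ) : ZMod M × ZMod M →+ ZMod M × ZMod M := AddMonoidHom.id _ - rot M

lemma subRot_apply (x : ZMod M × ZMod M) : subRot M x = x - rot M x := rfl

lemma subRot_surjective {N : ℕ} (hM : M = 2 * N + 1) : Function.Surjective (subRot M) := by
  have h : (2 * N + 1 : ZMod M) = 0 := by
    have := ZMod.natCast_self M
    rw [hM] at this ⊢
    exact_mod_cast this
  intro x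
  refine ⟨(-N * (x.1 - x.2), -N * (x.1 + x.2)), ?_⟩
  ext
  · simp [subRot_apply, rot_apply]
    linear_combination (-x.1) * h
  · simp [subRot_apply, rot_apply]
    linear_combination (-x.2) * h

lemma TriangleFree.eq_of_red {N : ℕ} (hM : M = 2 * N + 1) {A : Finset (ℤ × ℤ)} (hA : A ⊆ square N)
    (hfree : TriangleFree A) {a b : ZMod M × ZMod M} (ha : a ∈ redSet M A) (hb : b ∈ redSet M A)
    (hc : a + rot M (b - a) ∈ redSet M A) : b = a := by
  simp only [redSet, mem_image] at ha hb hc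
  obtain ⟨p, hp, rfl⟩ := ha
  obtain ⟨r, hr, rfl⟩ := hb
  obtain ⟨t, ht, h⟩ := hc
  by_contra hne
  have hp' := mem_square.1 (hA hp)
  have hr' := mem_square.1 (hA hr)
  have ht' := mem_square.1 (hA ht)
  simp only [red, rot_apply, Prod.mk_add_mk, Prod.mk_sub_mk, Prod.mk.injEq] at h
  have h1 : t.1 = p.1 + -(r.2 - p.2) :=
    eq_of_cast_eq (M := M) (by rw [abs_lt]; constructor <;> omega) (by push_cast; exact h.1)
  have h2 : t.2 = p.2 + (r.1 - p.1) :=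
    eq_of_cast_eq (M := M) (by rw [abs_lt]; constructor <;> omega) (by push_cast; exact h.2)
  refine hfree ⟨p, r - p, ?_, hp, by simpa using hr, ?_⟩
  · intro h0
    exact hne (by rw [sub_eq_zero.1 h0])
  · convert ht using 1
    ext <;> simp [h1, h2]

lemma tri_ind_le [NeZero M] {N : ℕ} (hM : M = 2 * N + 1) {A : Finset (ℤ × ℤ)} (hA : A ⊆ square N)
    (hfree : TriangleFree A) : tri (subRot M) (rot M) (ind (redSet M A)) ≤ #A := by
  rw [← card_redSet (M := M) (by omega) hA, ← sum_ind]
  refine sum_le_sum fun a _ ↦ ?_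
  rw [sum_eq_single a]
  · have h1 := ind_nonneg (redSet M A) a
    have h2 := ind_le_one (redSet M A) a
    have h3 := ind_nonneg (redSet M A) (subRot M a + rot M a)
    have h4 := ind_le_one (redSet M A) (subRot M a + rot M a)
    have h5 : ind (redSet M A) a * ind (redSet M A) a ≤ ind (redSet M A) a := by nlinarith
    nlinarith [mul_nonneg h1 h1]
  · intro b _ hba
    by_contra hne
    have hmem : ∀ x, ind (redSet M A) x ≠ 0 → x ∈ redSet M A := by
      intro x hx
      by_contra h
      exact hx (by simp [ind, h])
    have h1 := left_ne_zero_of_mul hne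
    refine hba (hfree.eq_of_red hM hA (hmem _ (left_ne_zero_of_mul h1))
      (hmem _ (right_ne_zero_of_mul h1)) ?_)
    have := hmem _ (right_ne_zero_of_mul hne)
    rw [subRot_apply] at this
    convert this using 1
    rw [map_sub]
    abel
  · simp

lemma le_tri_ind_square [NeZero M] {N : ℕ} (hNM : N ≤ M) :
    (((N / 3) ^ 4 : ℕ) : ℝ) ≤ tri (subRot M) (rot M) (ind (redSet M (square N))) := by
  set m := N / 3 with hm
  set B := redSet M (square N) with hB
  set T : Finset (ℤ × ℤ) := Ico (m : ℤ) (2 * m) ×ˢ Ico (m : ℤ) (2 * m) with hT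
  have hTsub : T ⊆ square N := by
    intro p hp
    simp only [hT, mem_product, mem_Ico] at hp
    rw [mem_square]
    omega
  have hTc : #(redSet M T) = m ^ 2 := by
    rw [card_redSet hNM hTsub, hT, card_product, Int.card_Ico]
    have : (2 * (m : ℤ) - m).toNat = m := by omega
    rw [this, sq]
  have hterm : ∀ a ∈ redSet M T, ∀ b ∈ redSet M T,
      (1 : ℝ) ≤ ind B a * ind B b * ind B (subRot M a + rot M b) := by
    intro a ha b hb
    simp only [redSet, mem_image] at ha hb
    obtain ⟨p, hp, rfl⟩ := ha
    obtain ⟨r, hr, rfl⟩ := hb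
    have h1 : red M p ∈ B := mem_image_of_mem _ (hTsub hp)
    have h2 : red M r ∈ B := mem_image_of_mem _ (hTsub hr)
    have h3 : subRot M (red M p) + rot M (red M r) ∈ B := by
      refine mem_image.2 ⟨(p.1 + p.2 - r.2, p.2 - p.1 + r.1), ?_, ?_⟩
      · simp only [hT, mem_product, mem_Ico] at hp hr
        rw [mem_square]
        dsimp only
        omega
      · ext <;> simp [red, subRot_apply, rot_apply]
        ring
    simp [ind, h1, h2, h3]
  have hnn : ∀ a b, 0 ≤ ind B a * ind B b * ind B (subRot M a + rot M b) := fun a b ↦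
    mul_nonneg (mul_nonneg (ind_nonneg _ _) (ind_nonneg _ _)) (ind_nonneg _ _)
  calc (((m ^ 4 : ℕ)) : ℝ) = #(redSet M T) • (#(redSet M T) • (1 : ℝ)) := by
        rw [hTc]; simp; ring
    _ ≤ ∑ a ∈ redSet M T, ∑ b ∈ redSet M T, ind B a * ind B b * ind B (subRot M a + rot M b) :=
        card_nsmul_le_sum _ _ _ fun a ha ↦ card_nsmul_le_sum _ _ _ fun b hb ↦ hterm a ha b hb
    _ ≤ ∑ a ∈ redSet M T, ∑ b, ind B a * ind B b * ind B (subRot M a + rot M b) :=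
        sum_le_sum fun a _ ↦ sum_le_univ_sum_of_nonneg fun b ↦ hnn a b
    _ ≤ _ := sum_le_univ_sum_of_nonneg fun a ↦ sum_nonneg fun b _ ↦ hnn a b

lemma card_strip_le (N R : ℕ) {d : ℤ} (hd : |d| ≤ R) :
    #{t ∈ Ico (0 : ℤ) N | t + d ∉ Ico (0 : ℤ) N} ≤ 2 * R := by
  rw [abs_le] at hd
  have hsub : {t ∈ Ico (0 : ℤ) N | t + d ∉ Ico (0 : ℤ) N}
      ⊆ Ico (0 : ℤ) R ∪ Ico ((N : ℤ) - R) N := by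
    intro t ht
    simp only [mem_filter, mem_union, mem_Ico] at ht ⊢
    omega
  refine (card_le_card hsub).trans ((card_union_le _ _).trans ?_)
  rw [Int.card_Ico, Int.card_Ico]
  omega

lemma card_square_shift_le (N R : ℕ) {d : ℤ × ℤ} (h1 : |d.1| ≤ R) (h2 : |d.2| ≤ R) :
    #{b ∈ redSet M (square N) | b + red M d ∉ redSet M (square N)} ≤ 4 * R * N := by
  have hsub : {b ∈ redSet M (square N) | b + red M d ∉ redSet M (square N)}
      ⊆ ({t ∈ Ico (0 : ℤ) N | t + d.1 ∉ Ico (0 : ℤ) N} ×ˢ Ico (0 : ℤ) N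
        ∪ Ico (0 : ℤ) N ×ˢ {t ∈ Ico (0 : ℤ) N | t + d.2 ∉ Ico (0 : ℤ) N}).image (red M) := by
    intro b hb
    rw [mem_filter] at hb
    obtain ⟨hb, hb'⟩ := hb
    obtain ⟨p, hp, rfl⟩ := mem_image.1 hb
    refine mem_image_of_mem _ ?_
    have hnot : p + d ∉ square N := by
      intro h
      exact hb' (by rw [← red_add]; exact mem_image_of_mem _ h)
    rw [mem_square] at hp hnot
    simp only [mem_union, mem_product, mem_filter, mem_Ico, Prod.fst_add, Prod.snd_add] at hnot ⊢
    omega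
  refine (card_le_card hsub).trans (card_image_le.trans ((card_union_le _ _).trans ?_))
  rw [card_product, card_product, Int.card_Ico]
  have e1 := card_strip_le N R h1
  have e2 := card_strip_le N R h2
  have e3 : ((N : ℤ) - 0).toNat = N := by omega
  rw [e3]
  nlinarith

/-- The trace of a triangle-free set on a dilated square grid is again triangle-free. -/
lemma TriangleFree.trace {N : ℕ} (hM : M = 2 * N + 1) {A : Finset (ℤ × ℤ)} (hA : A ⊆ square N)
    (hfree : TriangleFree A) {q L : ℕ} (hq : 0 < q) (hqL : q * L ≤ N) (x : ZMod M × ZMod M) :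
    TriangleFree {p ∈ square L | x + red M (q * p.1, q * p.2) ∈ redSet M A} := by
  rintro ⟨p, y, hy, hp, hpy, hpr⟩
  rw [mem_filter] at hp hpy hpr
  have hp1 := mem_square.1 hp.1
  have hpy1 := mem_square.1 hpy.1
  simp only [Prod.fst_add, Prod.snd_add] at hpy1
  have h := hfree.eq_of_red (M := M) hM hA hp.2 hpy.2 (by
    convert hpr.2 using 1
    ext <;> simp [red, rot_apply] <;> ring)
  have hz : red M (q * y.1, q * y.2) = 0 := by
    have e : red M (q * (p + y).1, q * (p + y).2)
        = red M (q * p.1, q * p.2) + red M (q * y.1, q * y.2) := by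
      rw [← red_add]; congr 1; ext <;> simp <;> ring
    rw [e] at h
    simpa using h
  simp only [red, Prod.mk_eq_zero] at hz
  have key : ∀ t : ℤ, |t| ≤ L → ((q * t : ℤ) : ZMod M) = 0 → t = 0 := by
    intro t ht h0
    have h1 : |(q : ℤ) * t| < M := by
      rw [abs_mul, Nat.abs_cast]
      have : (q : ℤ) * |t| ≤ q * L := mul_le_mul_of_nonneg_left ht (by positivity)
      have h2 : ((q * L : ℕ) : ℤ) ≤ N := by exact_mod_cast hqL
      push_cast at h2
      omega
    have h2 := eq_zero_of_cast_eq_zero h1 h0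
    rcases mul_eq_zero.1 h2 with h3 | h3
    · omega
    · exact h3
  exact hy (Prod.ext (key _ (by rw [abs_le]; constructor <;> omega) hz.1)
    (key _ (by rw [abs_le]; constructor <;> omega) hz.2))

end Triangles

/-- The density increment: a triangle-free set of side `N` has a large Fourier spectrum of some
size `K`, and for each `L` its density increases on some dilated grid of side `L`. -/
lemma exists_increment : ∃ c : ℝ, 0 < c ∧ ∀ (N : ℕ) (A : Finset (ℤ × ℤ)) (δ : ℝ),
    A ⊆ square N → TriangleFree A → (#A : ℝ) = δ * N ^ 2 → 0 < δ → 12 ≤ N →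
    512 < δ ^ 2 * N ^ 2 → ∃ K : ℕ, 0 < K ∧ c * δ * (K : ℝ) ^ (1 / 4 : ℝ) ≤ 9 ∧
      ∀ L : ℕ, 0 < L → ∃ q : ℕ, 0 < q ∧ q ≤ (16 * L + 1) ^ (4 * K) ∧
        (q * L ≤ N → ∃ A' ⊆ square L, TriangleFree A' ∧
          c * δ * (K : ℝ) ^ (1 / 4 : ℝ) * N * L ^ 2
            ≤ 36 * ((#A' - δ * L ^ 2) * N + 8 * (q * L) * L ^ 2)) := by
  obtain ⟨c₁, hc₁, hlarge⟩ := exists_large_sq_sum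
  set κ : ℝ := 1 / 4096 with hκ
  refine ⟨c₁ * κ ^ 2, by positivity, fun N A δ hA hfree hcard hδ hN hδN ↦ ?_⟩
  set M : ℕ := 2 * N + 1 with hM
  have : NeZero M := ⟨by omega⟩
  have hNr : (12 : ℝ) ≤ N := by exact_mod_cast hN
  have hN0 : (0 : ℝ) < N := by linarith
  set G := ZMod M × ZMod M with hG
  set A₁ : Finset G := redSet M A with hA₁
  set B₁ : Finset G := redSet M (square N) with hB₁
  have hsub : A₁ ⊆ B₁ := image_subset_image hA
  have cA : (#A₁ : ℝ) = δ * N ^ 2 := by rw [hA₁, card_redSet (by omega) hA, hcard]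
  have cB : (#B₁ : ℝ) = N ^ 2 := by
    rw [hB₁, card_redSet (by omega) subset_rfl, card_square]; push_cast; rfl
  have cG : (Fintype.card G : ℝ) = M ^ 2 := by simp [hG, ZMod.card, sq]
  have hMN : (M : ℝ) ^ 2 ≤ 9 * N ^ 2 := by rw [hM]; push_cast; nlinarith
  have hMN' : (N : ℝ) ^ 2 < M ^ 2 := by rw [hM]; push_cast; nlinarith
  set g : G → ℝ := fun x ↦ δ * ind B₁ x with hg
  set f : G → ℝ := fun x ↦ ind A₁ x - δ * ind B₁ x with hf
  have hgf : g + f = ind A₁ := by ext x; simp [hg, hf]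
  have sq_ind : ∀ (C : Finset G) x, ind C x ^ 2 = ind C x := by
    intro C x; unfold ind; split_ifs <;> norm_num
  set R : ℝ := δ ^ 3 * N ^ 4 * M ^ 2 with hR
  have hgR : ∑ ψ, ‖dft g ψ‖ ^ 3 ≤ R := by
    have h1 : ∀ ψ, ‖dft g ψ‖ ≤ δ * N ^ 2 := by
      intro ψ
      refine (norm_dft_le g ψ).trans (le_of_eq ?_)
      rw [← cB, ← sum_ind, mul_sum]
      exact sum_congr rfl fun x _ ↦ abs_of_nonneg (mul_nonneg hδ.le (ind_nonneg _ _))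
    have h2 : ∑ x, g x ^ 2 = δ ^ 2 * N ^ 2 := by
      simp only [hg, mul_pow, sq_ind, ← mul_sum, sum_ind, cB]
    calc ∑ ψ, ‖dft g ψ‖ ^ 3 ≤ ∑ ψ, δ * N ^ 2 * ‖dft g ψ‖ ^ 2 := by
          refine sum_le_sum fun ψ _ ↦ ?_
          rw [pow_succ' _ 2]
          exact mul_le_mul_of_nonneg_right (h1 ψ) (by positivity)
      _ = R := by rw [← mul_sum, sum_norm_dft_sq, h2, cG, hR]; ring
  have htriB : (N : ℝ) ^ 4 / 256 ≤ tri (subRot M) (rot M) (ind B₁) := by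
    refine le_trans ?_ (le_tri_ind_square (by omega))
    have h1 : (N : ℝ) / 4 ≤ ((N / 3 : ℕ) : ℝ) := by
      have : N ≤ 4 * (N / 3) := by omega
      have : (N : ℝ) ≤ 4 * ((N / 3 : ℕ) : ℝ) := by exact_mod_cast this
      linarith
    have := pow_le_pow_left₀ (by positivity) h1 4
    push_cast at this ⊢
    refine le_trans (le_of_eq ?_) this
    ring
  have htrig : tri (subRot M) (rot M) g = δ ^ 3 * tri (subRot M) (rot M) (ind B₁) := by
    simp only [tri, hg, mul_sum]
    exact sum_congr rfl fun a _ ↦ sum_congr rfl fun b _ ↦ by ring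
  have hfR : κ ^ 3 * R < ∑ ψ, ‖dft f ψ‖ ^ 3 := by
    by_contra! hcon
    have h1 := card_mul_abs_tri_sub_le (subRot_surjective hM) rot_surjective
      (by norm_num [hκ] : 0 < κ) (by norm_num [hκ]) g f hgR hcon
    rw [hgf, htrig, cG, hR] at h1
    have h2 : |tri (subRot M) (rot M) (ind A₁) - δ ^ 3 * tri (subRot M) (rot M) (ind B₁)|
        ≤ δ ^ 3 * N ^ 4 / 512 := by
      have hM2 : (0 : ℝ) < M ^ 2 := by nlinarith
      refine le_of_mul_le_mul_left (h1.trans (le_of_eq ?_)) hM2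
      rw [hκ]; ring
    have h3 := (abs_le.1 h2).1
    have h4 : tri (subRot M) (rot M) (ind A₁) ≤ δ * N ^ 2 := by
      rw [← hcard]; exact tri_ind_le hM hA hfree
    have h5 := mul_le_mul_of_nonneg_left htriB (by positivity : 0 ≤ δ ^ 3)
    have h6 := mul_lt_mul_of_pos_left hδN (by positivity : 0 < δ * N ^ 2)
    nlinarith
  obtain ⟨S, -, hSne, hS⟩ := hlarge univ (fun ψ ↦ ‖dft f ψ‖) (κ * (δ * N ^ 2))
    (fun _ ↦ norm_nonneg _) (by positivity) (by
      refine lt_of_lt_of_le ?_ hfR.le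
      rw [hR, hκ]
      have : (0 : ℝ) < δ ^ 3 * N ^ 4 := by positivity
      nlinarith)
  set t : ℝ := (#S : ℝ) ^ (1 / 4 : ℝ) with ht
  have hδN4 : (0 : ℝ) < δ * N ^ 4 := by positivity
  refine ⟨#S, hSne.card_pos, ?_, fun L hL ↦ ?_⟩
  · have h1 : ∑ ψ ∈ S, ‖dft f ψ‖ ^ 2 ≤ M ^ 2 * (δ * N ^ 2) := by
      refine (sum_le_univ_sum_of_nonneg fun ψ ↦ by positivity).trans ?_
      rw [sum_norm_dft_sq, cG]
      refine mul_le_mul_of_nonneg_left ?_ (by positivity)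
      have h2 : ∀ x, f x ^ 2 ≤ ind A₁ x - 2 * δ * ind A₁ x + δ ^ 2 * ind B₁ x := by
        intro x
        by_cases hx : x ∈ A₁
        · have := hsub hx
          simp only [hf, ind, hx, this, if_true]
          nlinarith
        · simp only [hf, ind, hx, if_false]
          split_ifs <;> nlinarith
      refine (sum_le_sum fun x _ ↦ h2 x).trans (le_of_eq_of_le (b := δ * N ^ 2 - δ ^ 2 * N ^ 2) ?_ ?_)
      · rw [sum_add_distrib, sum_sub_distrib, ← mul_sum, ← mul_sum, sum_ind, sum_ind, cA, cB]
        ring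
      · have : 0 ≤ δ ^ 2 * (N : ℝ) ^ 2 := by positivity
        linarith
    have h3 : δ * N ^ 4 * (c₁ * κ ^ 2 * δ * t) ≤ δ * N ^ 4 * 9 := by
      calc _ = c₁ * (κ * (δ * N ^ 2)) ^ 2 * t := by ring
        _ ≤ _ := hS.trans h1
        _ ≤ 9 * N ^ 2 * (δ * N ^ 2) := by gcongr
        _ = _ := by ring
    exact le_of_mul_le_mul_left h3 hδN4
  · obtain ⟨q, hq, hqle, hchar⟩ := exists_dilate ((1, 0) : G) (0, 1) S hL
    refine ⟨q, hq, hqle, fun hqL ↦ ?_⟩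
    set T : G → Finset (ℤ × ℤ) :=
      fun x ↦ {p ∈ square L | x + red M (q * p.1, q * p.2) ∈ A₁} with hT
    obtain ⟨x₀, -, hx₀⟩ := exists_max_image (univ : Finset G) (fun x ↦ #(T x)) univ_nonempty
    refine ⟨T x₀, filter_subset _ _, hfree.trace hM hA hq hqL x₀, ?_⟩
    set P := range L ×ˢ range L with hP
    have cP : (#P : ℝ) = L ^ 2 := by simp [hP, sq]
    set s : ℕ × ℕ → G := fun p ↦ (q * p.1) • ((1, 0) : G) + (q * p.2) • ((0, 1) : G) with hs
    have s_eq : ∀ p, s p = red M (q * (p.1 : ℤ), q * (p.2 : ℤ)) := by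
      intro p
      ext <;> simp [hs, red]
    have hm : ∀ x, (#{p ∈ P | x + s p ∈ A₁} : ℝ) ≤ #(T x₀) := by
      intro x
      refine le_trans ?_ (Nat.cast_le.2 (hx₀ x (mem_univ x)))
      refine Nat.cast_le.2 (card_le_card_of_injOn (fun p ↦ ((p.1 : ℤ), (p.2 : ℤ))) ?_ ?_)
      · intro p hp
        simp only [mem_coe, mem_filter, hP, mem_product, mem_range] at hp
        simp only [hT, mem_coe, mem_filter, mem_square]
        refine ⟨by omega, ?_⟩
        rw [← s_eq]; exact hp.2
      · intro p _ r _ h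
        simpa [Prod.ext_iff] using h
    have he : ∀ p ∈ P, ∀ p' ∈ P,
        (#{b ∈ B₁ | b + (s p' - s p) ∉ B₁} : ℝ) ≤ 4 * (q * L) * N := by
      intro p hp p' hp'
      simp only [hP, mem_product, mem_range] at hp hp'
      have e : s p' - s p = red M (q * ((p'.1 : ℤ) - p.1), q * ((p'.2 : ℤ) - p.2)) := by
        rw [s_eq, s_eq, sub_eq_iff_eq_add, ← red_add]
        congr 1; ext <;> simp <;> ring
      have hb : ∀ a b : ℕ, a < L → b < L → |(q : ℤ) * ((a : ℤ) - b)| ≤ (q * L : ℕ) := by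
        intro a b ha hb
        rw [abs_mul, Nat.abs_cast]
        push_cast
        refine mul_le_mul_of_nonneg_left ?_ (by positivity)
        rw [abs_le]; constructor <;> omega
      rw [e]
      have := card_square_shift_le (M := M) N (q * L)
        (d := (q * ((p'.1 : ℤ) - p.1), q * ((p'.2 : ℤ) - p.2)))
        (hb _ _ hp'.1 hp.1) (hb _ _ hp'.2 hp.2)
      exact_mod_cast this
    have h1 := sum_sq_translate_le P s hsub hδ.le (by rw [cA, cB]) hm he
    have h2 := sum_norm_dft_sq_le P s f S hchar
    rw [cG] at h2
    rw [cP] at h1 h2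
    rw [cB] at h1
    have hL0 : (0 : ℝ) < L ^ 2 := by
      have : (0 : ℝ) < L := by exact_mod_cast hL
      positivity
    set W := ∑ x, (∑ p ∈ P, f (x + s p)) ^ 2 with hW
    have hW1 : W ≤ L ^ 2 * (#(T x₀) * δ * N ^ 2 - δ ^ 2 * L ^ 2 * N ^ 2
        + 2 * δ * L ^ 2 * (4 * (q * L) * N)) := h1
    have hW0 : 0 ≤ W := sum_nonneg fun x _ ↦ sq_nonneg _
    generalize (#(T x₀) : ℝ) = a at hW1 ⊢
    generalize ∑ ψ ∈ S, ‖dft f ψ‖ ^ 2 = V at hS h2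
    clear_value W κ
    have h3 : (δ * N ^ 3 * L ^ 2) * (c₁ * κ ^ 2 * δ * t * N * L ^ 2)
        ≤ (δ * N ^ 3 * L ^ 2)
          * (36 * ((a - δ * L ^ 2) * N + 8 * (q * L) * L ^ 2)) := by
      calc _ = ((L : ℝ) ^ 2) ^ 2 * (c₁ * (κ * (δ * N ^ 2)) ^ 2 * t) := by ring
        _ ≤ ((L : ℝ) ^ 2) ^ 2 * V := by gcongr
        _ ≤ 4 * (M ^ 2 * W) := by linarith
        _ ≤ 4 * (9 * N ^ 2 * W) := by gcongr
        _ ≤ 4 * (9 * N ^ 2 * (L ^ 2 * (a * δ * N ^ 2 - δ ^ 2 * L ^ 2 * N ^ 2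
              + 2 * δ * L ^ 2 * (4 * (q * L) * N)))) := by gcongr
        _ = _ := by ring
    rw [← ht]
    exact le_of_mul_le_mul_left h3 (by positivity)

set_option maxHeartbeats 800000 in
lemma exists_pow_mul_log_le : ∃ D : ℕ, 0 < D ∧ ∃ C : ℝ, 0 < C ∧ ∀ N : ℕ, 0 < N →
    ∀ A ⊆ square N, TriangleFree A → ((#A : ℝ) / N ^ 2) ^ D * Real.log N ≤ C := by
  obtain ⟨c, hc, hinc⟩ := exists_increment
  set c₂ : ℝ := c / 72 with hc₂
  have hc₂0 : 0 < c₂ := by positivity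
  obtain ⟨m, hm⟩ := pow_unbounded_of_one_lt (20 / c₂ ^ 4) (by linarith : 1 < 1 + c₂)
  set C : ℝ := 23 + 360 * 6561 / c ^ 4 + 1152 / c with hC
  have hC1 : 23 < C := by
    have : 0 < 360 * 6561 / c ^ 4 := by positivity
    have : 0 < 1152 / c := by positivity
    linarith
  have hC2 : 360 * 6561 / c ^ 4 ≤ C := by
    have : 0 < 1152 / c := by positivity
    linarith
  have hC3 : 1152 / c ≤ C := by
    have : 0 < 360 * 6561 / c ^ 4 := by positivity
    linarith
  rw [div_le_iff₀ (by positivity)] at hC2 hC3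
  have hC0 : 0 < C := by linarith
  clear_value C
  clear hC
  refine ⟨4 + m, by omega, C, hC0, fun N ↦ ?_⟩
  induction N using Nat.strong_induction_on with
  | _ N ih =>
    intro hN A hA hfree
    by_contra! hcon
    set δ : ℝ := (#A : ℝ) / N ^ 2 with hδ
    set l : ℝ := Real.log N with hl
    have hN0 : (0 : ℝ) < N := by exact_mod_cast hN
    have hcard : (#A : ℝ) = δ * N ^ 2 := by
      rw [hδ, div_mul_cancel₀ _ (pow_ne_zero 2 hN0.ne')]
    have hl0 : 0 ≤ l := Real.log_natCast_nonneg N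
    have hδ0 : 0 < δ := by
      rcases (div_nonneg (Nat.cast_nonneg #A) (sq_nonneg (N : ℝ))).eq_or_lt with h | h
      · rw [hδ, ← h, zero_pow (by omega), zero_mul] at hcon
        linarith
      · exact h
    have hδ1 : δ ≤ 1 := by
      rw [hδ, div_le_one (by positivity)]
      have := card_le_card hA
      rw [card_square] at this
      exact_mod_cast this
    clear_value δ
    have hδl : C < δ ^ 4 * l := by
      refine hcon.trans_le ?_
      exact mul_le_mul_of_nonneg_right (pow_le_pow_of_le_one hδ0.le hδ1 (by omega)) hl0
    have hδ4 : δ ^ 4 ≤ δ := by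
      simpa using pow_le_pow_of_le_one hδ0.le hδ1 (show 1 ≤ 4 by norm_num)
    have hδl' : C < δ * l := hδl.trans_le (mul_le_mul_of_nonneg_right hδ4 hl0)
    have hlN : l ≤ N := by
      have := Real.add_one_le_exp l
      rw [hl, Real.exp_log hN0] at this
      linarith
    have hδN : C < δ * N := hδl'.trans_le (mul_le_mul_of_nonneg_left hlN hδ0.le)
    have hN12 : 12 ≤ N := by
      have : (12 : ℝ) ≤ N := by nlinarith
      exact_mod_cast this
    obtain ⟨K, hK, hKt, hstep⟩ := hinc N A δ hA hfree hcard hδ0 hN12 (by nlinarith)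
    set t : ℝ := (K : ℝ) ^ (1 / 4 : ℝ) with ht
    have hK1 : (1 : ℝ) ≤ K := by exact_mod_cast hK
    have ht1 : 1 ≤ t := Real.one_le_rpow hK1 (by norm_num)
    have ht4 : t ^ 4 = K := by
      rw [ht, ← Real.rpow_natCast, ← Real.rpow_mul (by positivity)]; norm_num
    clear_value t
    have hKl : 360 * K ≤ l := by
      have h1 : (c * δ * t) ^ 4 ≤ 9 ^ 4 := pow_le_pow_left₀ (by positivity) hKt 4
      rw [mul_pow, mul_pow, ht4] at h1
      have h2 : c ^ 4 * C < c ^ 4 * (δ ^ 4 * l) := mul_lt_mul_of_pos_left hδl (by positivity)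
      have h3 : (c ^ 4 * δ ^ 4) * (360 * K) ≤ (c ^ 4 * δ ^ 4) * l := by nlinarith
      exact le_of_mul_le_mul_left h3 (by positivity)
    set X : ℝ := Real.exp (l / (20 * K)) with hX
    have hX18 : 18 ≤ X := by
      have h1 : 18 ≤ l / (20 * K) := by
        rw [le_div_iff₀ (by positivity)]; linarith
      linarith [Real.add_one_le_exp (l / (20 * K))]
    set L : ℕ := ⌊X ^ 2 / 17⌋₊ with hLdef
    have hLX : X ≤ L := by
      have := Nat.lt_floor_add_one (X ^ 2 / 17)
      rw [← hLdef, div_lt_iff₀ (by norm_num)] at this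
      nlinarith
    have hXL : 17 * (L : ℝ) ≤ X ^ 2 := by
      have := Nat.floor_le (by positivity : 0 ≤ X ^ 2 / 17)
      rw [← hLdef, le_div_iff₀ (by norm_num)] at this
      linarith
    have hL1 : (1 : ℝ) ≤ L := by linarith
    have hL : 0 < L := by exact_mod_cast (by linarith : (0 : ℝ) < L)
    set E : ℝ := Real.exp (l / 2) with hE
    have hE2 : E * E = N := by
      rw [hE, ← Real.exp_add, add_halves, hl, Real.exp_log hN0]
    have hEl : l / 2 ≤ E := by linarith [Real.add_one_le_exp (l / 2)]
    have hE1 : 1 < E := by nlinarith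
    have hXE : (X ^ 2) ^ (5 * K) = E := by
      rw [hX, hE, ← pow_mul, ← Real.exp_nat_mul]
      congr 1
      push_cast
      field_simp
      ring
    obtain ⟨q, hq, hqle, hq'⟩ := hstep L hL
    have hqL : (q : ℝ) * L ≤ E := by
      have h1 : (q : ℝ) ≤ (17 * L) ^ (4 * K) := by
        have : (q : ℝ) ≤ (16 * L + 1) ^ (4 * K) := by exact_mod_cast hqle
        refine this.trans (pow_le_pow_left₀ (by positivity) (by linarith) _)
      have h2 : (L : ℝ) ≤ (17 * L) ^ K := by
        calc (L : ℝ) ≤ 17 * L := by linarith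
          _ = (17 * L) ^ 1 := (pow_one _).symm
          _ ≤ (17 * L) ^ K := pow_le_pow_right₀ (by linarith) hK
      calc (q : ℝ) * L ≤ (17 * L) ^ (4 * K) * (17 * L) ^ K := by gcongr
        _ = (17 * L) ^ (5 * K) := by rw [← pow_add]; congr 1; ring
        _ ≤ (X ^ 2) ^ (5 * K) := by gcongr
        _ = E := hXE
    clear_value E X L l
    have hEN : E < N := by
      rw [← hE2]
      exact lt_mul_of_one_lt_right (by linarith) hE1
    have hq1 : (1 : ℝ) ≤ q := by exact_mod_cast hq
    have hLN : L < N := by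
      have : (L : ℝ) ≤ q * L := le_mul_of_one_le_left (by linarith) hq1
      have : (L : ℝ) < N := by linarith
      exact_mod_cast this
    obtain ⟨A', hA', hfree', hbound⟩ := hq' (by exact_mod_cast (hqL.trans hEN.le))
    have hih := ih L hLN hL A' hA' hfree'
    set δ' : ℝ := (#A' : ℝ) / L ^ 2 with hδ'
    have hcard' : (#A' : ℝ) = δ' * L ^ 2 := by 
      rw [hδ', div_mul_cancel₀ _ (pow_ne_zero 2 (by linarith))]
    clear_value δ'
    have hgain : δ * (1 + c₂ * t) ≤ δ' := by
      rw [hcard'] at hbound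
      have h1 : (E * L ^ 2) * (E * (c * δ * t)) ≤ (E * L ^ 2) * (E * (36 * (δ' - δ)) + 288) := by
        have : 0 ≤ (L : ℝ) ^ 2 * (E - q * L) := mul_nonneg (by positivity) (by linarith)
        rw [← hE2] at hbound
        linarith
      have h2 := le_of_mul_le_mul_left h1 (by positivity)
      have h3 : 576 ≤ E * (c * δ * t) := by
        have e1 : 1152 ≤ c * (δ * l) := by
          have := mul_le_mul_of_nonneg_left hδl'.le hc.le
          linarith
        have e2 : c * δ * (l / 2) ≤ c * δ * E := mul_le_mul_of_nonneg_left hEl (by positivity)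
        have e3 : E * (c * δ) * 1 ≤ E * (c * δ) * t :=
          mul_le_mul_of_nonneg_left ht1 (by positivity)
        linarith
      have h4 : E * (c * δ * t) ≤ E * (72 * (δ' - δ)) := by linarith
      have h5 := le_of_mul_le_mul_left h4 (by linarith)
      rw [hc₂]
      linarith
    have hlogL : l / (20 * K) ≤ Real.log L := by
      rw [Real.le_log_iff_exp_le (by linarith)]
      rwa [← hX]
    have hpow : 20 * (K : ℝ) ≤ (1 + c₂ * t) ^ (4 + m) := by
      rw [div_lt_iff₀ (by positivity)] at hm
      rw [pow_add, ← ht4]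
      have h1 : (c₂ * t) ^ 4 ≤ (1 + c₂ * t) ^ 4 := pow_le_pow_left₀ (by positivity) (by linarith) 4
      have h2 : (1 + c₂) ^ m ≤ (1 + c₂ * t) ^ m :=
        pow_le_pow_left₀ (by positivity) (by nlinarith) m
      calc 20 * t ^ 4 ≤ (1 + c₂) ^ m * c₂ ^ 4 * t ^ 4 := by gcongr
        _ = (c₂ * t) ^ 4 * (1 + c₂) ^ m := by ring
        _ ≤ _ := by gcongr
    have hδ'0 : 0 ≤ δ' := le_trans (by positivity) hgain
    have hfinal : δ ^ (4 + m) * l ≤ δ' ^ (4 + m) * Real.log L := by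
      calc δ ^ (4 + m) * l = δ ^ (4 + m) * (20 * K) * (l / (20 * K)) := by field_simp
        _ ≤ δ ^ (4 + m) * (1 + c₂ * t) ^ (4 + m) * (l / (20 * K)) := by gcongr
        _ = (δ * (1 + c₂ * t)) ^ (4 + m) * (l / (20 * K)) := by rw [mul_pow]
        _ ≤ _ := by gcongr
    linarith

end RightTriangle

/-- Density bound for sets without isosceles right triangles: there exist
`c₁ > 0`, `C > 0` and `N₀` such that for all `n ≥ N₀`, every `A ⊆ [n] × [n] ⊂ ℤ²`
with no configuration `x, x + y, x + y⊥` (`y ≠ 0`, `y⊥ = (-y₂, y₁)`) satisfies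
`|A| ≤ C·n²/(log n)^c₁`. -/
theorem no_isosceles_right_triangle_density :
    ∃ c₁ : ℝ, 0 < c₁ ∧ ∃ C : ℝ, 0 < C ∧ ∃ N₀ : ℕ, ∀ n : ℕ, N₀ ≤ n →
      ∀ A : Finset (ℤ × ℤ),
        A ⊆ Finset.Ico (0 : ℤ) (n : ℤ) ×ˢ Finset.Ico (0 : ℤ) (n : ℤ) →
        (¬ ∃ x y : ℤ × ℤ, y ≠ 0 ∧ x ∈ A ∧ x + y ∈ A ∧ x + (-y.2, y.1) ∈ A) →
        (A.card : ℝ) ≤ C * (n : ℝ) ^ 2 / (Real.log n) ^ c₁ := by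
  obtain ⟨D, hD, C, hC, h⟩ := RightTriangle.exists_pow_mul_log_le
  refine ⟨(D : ℝ)⁻¹, by positivity, C ^ (D : ℝ)⁻¹, by positivity, 2, fun n hn A hA hfree ↦ ?_⟩
  have hn0 : (0 : ℝ) < n := by exact_mod_cast (by omega : 0 < n)
  have hlog : 0 < Real.log n := Real.log_pos (by exact_mod_cast (by omega : 1 < n))
  have h1 := h n (by omega) A hA hfree
  rw [← le_div_iff₀ hlog] at h1
  have h2 := Real.rpow_le_rpow (by positivity) h1 (by positivity : (0 : ℝ) ≤ (D : ℝ)⁻¹)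
  rw [Real.pow_rpow_inv_natCast (by positivity) hD.ne', Real.div_rpow hC.le hlog.le,
    div_le_iff₀ (by positivity)] at h2
  exact h2.trans (le_of_eq (by ring))
end
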